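/- arXiv:2106.08726 — 10 statements merged into one kernel-verified Lean document; each statement's English description precedes it below -/
import Mathlib

section
/- Assume condition (torte). Then for every λ ∈ ℂ, E^{-1}A − λ = {(T(E z), z + (μ − λ) T(E z)) : z ∈ dom A} = {(x, y) ∈ dom A × dom A : x + (μ − λ) T(E x) = T(E y)}. -/
variable {X Y : Type*} [NormedAddCommGroup X] [NormedSpace ℂ X]
  [NormedAddCommGroup Y] [NormedSpace ℂ Y]

/-- The kernel representation `E⁻¹A - λ` of the pencil `λ E - A`:
the set `{(x, y) ∈ dom A × dom A : A x = E (y + λ x)}`. -/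
def kerRepShift (E : X →L[ℂ] Y) (dom : Submodule ℂ X) (A : ↥dom →ₗ[ℂ] Y)
    (lam : ℂ) : Set (↥dom × ↥dom) :=
  {p | A p.1 = E ((p.2 : X) + lam • (p.1 : X))}

/-- If `T` is the inverse of `A - μ E`, then `A x = y + μ E x` exactly when `x = T y`. -/
theorem apply_eq_iff_eq_resolvent_apply {X Y : Type*}
    [NormedAddCommGroup X] [NormedSpace ℂ X] [NormedAddCommGroup Y] [NormedSpace ℂ Y]
    {E : X →L[ℂ] Y} {dom : Submodule ℂ X} {A : ↥dom →ₗ[ℂ] Y} {μ : ℂ} {T : Y →L[ℂ] X}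
    (hTdom : ∀ y : Y, T y ∈ dom)
    (hT1 : ∀ y : Y, A ⟨T y, hTdom y⟩ - μ • E (T y) = y)
    (hT2 : ∀ x : ↥dom, T (A x - μ • E (x : X)) = (x : X)) (x : ↥dom) (y : Y) :
    A x = y + μ • E (x : X) ↔ (x : X) = T y := by
  rw [← sub_eq_iff_eq_add]
  constructor
  · rintro rfl
    exact (hT2 x).symm
  · intro h
    obtain rfl : x = ⟨T y, hTdom y⟩ := Subtype.ext h
    exact hT1 y

/-- Under condition (torte), for every `λ ∈ ℂ`,
`E⁻¹A - λ = {(T (E z), z + (μ - λ) T (E z)) : z ∈ dom A}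
          = {(x, y) ∈ dom A × dom A : x + (μ - λ) T (E x) = T (E y)}`. -/
theorem stmt2 {X Y : Type*}
    [NormedAddCommGroup X] [NormedSpace ℂ X] [CompleteSpace X]
    [NormedAddCommGroup Y] [NormedSpace ℂ Y] [CompleteSpace Y]
    (E : X →L[ℂ] Y) (dom : Submodule ℂ X) (A : ↥dom →ₗ[ℂ] Y)
    (hdense : Dense (dom : Set X))
    (hgraph : IsClosed {p : X × Y | ∃ x : ↥dom, p = ((x : X), A x)})
    (μ : ℂ) (T : Y →L[ℂ] X)
    (hTdom : ∀ y : Y, T y ∈ dom)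
    (hT1 : ∀ y : Y, A ⟨T y, hTdom y⟩ - μ • E (T y) = y)
    (hT2 : ∀ x : ↥dom, T (A x - μ • E (x : X)) = (x : X)) :
    ∀ lam : ℂ,
      kerRepShift E dom A lam
        = {p : ↥dom × ↥dom | ∃ z : ↥dom,
            p = (⟨T (E (z : X)), hTdom _⟩,
                 z + (μ - lam) • (⟨T (E (z : X)), hTdom _⟩ : ↥dom))} ∧
      kerRepShift E dom A lam
        = {p : ↥dom × ↥dom |
            ((p.1 : X)) + (μ - lam) • T (E (p.1 : X)) = T (E (p.2 : X))} := by
  intro lam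
  have key (p : ↥dom × ↥dom) : p ∈ kerRepShift E dom A lam ↔
      (p.1 : X) = T (E ((p.2 : X) - (μ - lam) • (p.1 : X))) := by
    rw [← apply_eq_iff_eq_resolvent_apply hTdom hT1 hT2, kerRepShift, Set.mem_ofPred_eq,
      ← map_smul, ← map_add]
    congr! 2
    module
  constructor
  · ext ⟨x, y⟩
    rw [key]
    constructor
    · intro h
      have hx : x = ⟨T (E ((y : X) - (μ - lam) • (x : X))), hTdom _⟩ := Subtype.ext h
      refine ⟨y - (μ - lam) • x, Prod.ext hx (Subtype.ext ?_)⟩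
      simp only [Submodule.coe_add, Submodule.coe_sub, Submodule.coe_smul]
      rw [← h, sub_add_cancel]
    · rintro ⟨z, hz⟩
      obtain ⟨rfl, rfl⟩ := Prod.mk.inj hz
      simp
  · ext ⟨x, y⟩
    rw [key, Set.mem_ofPred_eq, map_sub, map_sub, map_smul, map_smul, eq_sub_iff_add_eq]
end

section
/- Assume condition (torte). Then for every λ ∈ ℂ: {x : (x, 0) ∈ E^{-1}A − λ} = {x ∈ dom A : A x = λ E x}, and {y : (y, 0) ∈ AE^{-1} − λ} = {A x − μ E x : x ∈ dom A, A x = λ E x} (the kernel of the range representation at λ equals the image under A − μE of the kernel of the pencil λE − A). -/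
variable {X Y : Type*} [NormedAddCommGroup X] [NormedSpace ℂ X]
  [NormedAddCommGroup Y] [NormedSpace ℂ Y]

/-- The range representation `A E⁻¹ - λ`: the set `{(E x, A x - λ E x) : x ∈ dom A}`. -/
def ranRepShift (E : X →L[ℂ] Y) (dom : Submodule ℂ X) (A : ↥dom →ₗ[ℂ] Y)
    (lam : ℂ) : Set (Y × Y) :=
  {p | ∃ x : ↥dom, p = (E (x : X), A x - lam • E (x : X))}

/-- Under condition (torte), for every `λ ∈ ℂ`, the kernel of the
kernel representation at `λ` equals the kernel `{x ∈ dom A : A x = λ E x}` of the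
pencil, and the kernel of the range representation at `λ` equals the image of the
kernel of the pencil under `A - μ E`. -/
theorem stmt4 {X Y : Type*}
    [NormedAddCommGroup X] [NormedSpace ℂ X] [CompleteSpace X]
    [NormedAddCommGroup Y] [NormedSpace ℂ Y] [CompleteSpace Y]
    (E : X →L[ℂ] Y) (dom : Submodule ℂ X) (A : ↥dom →ₗ[ℂ] Y)
    (hdense : Dense (dom : Set X))
    (hgraph : IsClosed {p : X × Y | ∃ x : ↥dom, p = ((x : X), A x)})
    (μ : ℂ) (T : Y →L[ℂ] X)
    (hTdom : ∀ y : Y, T y ∈ dom)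
    (hT1 : ∀ y : Y, A ⟨T y, hTdom y⟩ - μ • E (T y) = y)
    (hT2 : ∀ x : ↥dom, T (A x - μ • E (x : X)) = (x : X)) :
    ∀ lam : ℂ,
      {x : ↥dom | (x, 0) ∈ kerRepShift E dom A lam}
        = {x : ↥dom | A x = lam • E (x : X)} ∧
      {y : Y | (y, 0) ∈ ranRepShift E dom A lam}
        = {y : Y | ∃ x : ↥dom, A x = lam • E (x : X) ∧ y = A x - μ • E (x : X)} := by
  intro lam
  refine ⟨?_, ?_⟩
  · ext x
    simp [kerRepShift]
  · ext y
    simp only [ranRepShift, Set.mem_ofPred_eq, Prod.mk.injEq]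
    constructor
    · rintro ⟨x, rfl, hx⟩
      have hx : A x = lam • E (x : X) := (sub_eq_zero.mp hx.symm)
      by_cases h : lam = μ
      · have h0 : (x : X) = 0 := by
          rw [← hT2 x, hx, h, sub_self, map_zero]
        exact ⟨0, by simp, by simp [h0]⟩
      · have h : lam - μ ≠ 0 := sub_ne_zero.mpr h
        refine ⟨(lam - μ)⁻¹ • x, ?_, ?_⟩
        · simp [hx, smul_comm lam]
        · rw [map_smul, hx, Submodule.coe_smul, map_smul, smul_comm μ, ← smul_sub, ← sub_smul,
            inv_smul_smul₀ h]
    · rintro ⟨x, hx, rfl⟩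
      refine ⟨(lam - μ) • x, ?_, ?_⟩
      · simp [hx, sub_smul]
      · rw [map_smul, hx, Submodule.coe_smul, map_smul, smul_comm lam, sub_self]
end

section
/- Assume condition (torte). Then for λ ∈ ℂ the following are equivalent: (i) the operator x ↦ λ E x − A x maps dom A bijectively onto Y; (ii) {y : (y, 0) ∈ AE^{-1} − λ} = {0} and {y : (x, y) ∈ AE^{-1} − λ for some x} = Y; (iii) {x : (x, 0) ∈ E^{-1}A − λ} = {0} and {y : (x, y) ∈ E^{-1}A − λ for some x} = dom A. (Equality of the resolvent sets of the pencil and of its range and kernel representations at finite points.) -/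
variable {X Y : Type*} [NormedAddCommGroup X] [NormedSpace ℂ X]
  [NormedAddCommGroup Y] [NormedSpace ℂ Y]

/-- Under condition (torte), for `λ ∈ ℂ` the following are
equivalent: (i) `x ↦ λ E x - A x` maps `dom A` bijectively onto `Y`;
(ii) the kernel of `A E⁻¹ - λ` is `{0}` and its range is all of `Y`;
(iii) the kernel of `E⁻¹A - λ` is `{0}` and its range is all of `dom A`. -/
theorem stmt7 {X Y : Type*}
    [NormedAddCommGroup X] [NormedSpace ℂ X] [CompleteSpace X]
    [NormedAddCommGroup Y] [NormedSpace ℂ Y] [CompleteSpace Y]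
    (E : X →L[ℂ] Y) (dom : Submodule ℂ X) (A : ↥dom →ₗ[ℂ] Y)
    (hdense : Dense (dom : Set X))
    (hgraph : IsClosed {p : X × Y | ∃ x : ↥dom, p = ((x : X), A x)})
    (μ : ℂ) (T : Y →L[ℂ] X)
    (hTdom : ∀ y : Y, T y ∈ dom)
    (hT1 : ∀ y : Y, A ⟨T y, hTdom y⟩ - μ • E (T y) = y)
    (hT2 : ∀ x : ↥dom, T (A x - μ • E (x : X)) = (x : X)) :
    ∀ lam : ℂ,
      (Function.Bijective (fun x : ↥dom => lam • E (x : X) - A x)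
        ↔ ({y : Y | (y, 0) ∈ ranRepShift E dom A lam} = {0} ∧
            {y : Y | ∃ x : Y, (x, y) ∈ ranRepShift E dom A lam} = Set.univ)) ∧
      (({y : Y | (y, 0) ∈ ranRepShift E dom A lam} = {0} ∧
            {y : Y | ∃ x : Y, (x, y) ∈ ranRepShift E dom A lam} = Set.univ)
        ↔ ({x : ↥dom | (x, 0) ∈ kerRepShift E dom A lam} = {0} ∧
            {y : ↥dom | ∃ x : ↥dom, (x, y) ∈ kerRepShift E dom A lam} = Set.univ)) := by
  intro lam
  have hinj {x : ↥dom} (h : A x - μ • E (x : X) = 0) : x = 0 :=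
    Subtype.ext (by rw [← hT2 x, h, map_zero]; rfl)
  have hbij : Function.Bijective (fun x : ↥dom => lam • E (x : X) - A x) ↔
      (∀ x : ↥dom, A x = lam • E (x : X) → x = 0) ∧
        ∀ y : Y, ∃ x : ↥dom, A x - lam • E (x : X) = y := by
    constructor
    · rintro ⟨hi, hs⟩
      refine ⟨fun x hx => hi (by simp [hx]), fun y => ?_⟩
      obtain ⟨x, hx⟩ := hs (-y)
      exact ⟨x, by simpa using congrArg Neg.neg hx⟩
    · rintro ⟨hi, hs⟩
      refine ⟨fun x₁ x₂ h => sub_eq_zero.mp (hi _ ?_), fun y => ?_⟩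
      · simp only at h
        rw [map_sub, Submodule.coe_sub, map_sub, smul_sub, sub_eq_sub_iff_sub_eq_sub.mp h]
      · obtain ⟨x, hx⟩ := hs (-y)
        exact ⟨x, by simpa using congrArg Neg.neg hx⟩
  have hran : ((∀ x : ↥dom, A x = lam • E (x : X) → x = 0) ∧
        ∀ y : Y, ∃ x : ↥dom, A x - lam • E (x : X) = y) ↔
      ({y : Y | (y, 0) ∈ ranRepShift E dom A lam} = {0} ∧
        {y : Y | ∃ x : Y, (x, y) ∈ ranRepShift E dom A lam} = Set.univ) := by
    simp only [Set.ext_iff, Set.mem_ofPred_eq, ranRepShift, Prod.mk.injEq,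
      Set.mem_singleton_iff, Set.mem_univ, iff_true]
    constructor
    · rintro ⟨hi, hs⟩
      refine ⟨fun y => ⟨?_, ?_⟩, fun y => ?_⟩
      · rintro ⟨x, rfl, hx⟩
        simp [hi x (sub_eq_zero.mp hx.symm)]
      · rintro rfl
        exact ⟨0, by simp, by simp⟩
      · obtain ⟨x, hx⟩ := hs y
        exact ⟨_, x, rfl, hx.symm⟩
    · rintro ⟨hi, hs⟩
      refine ⟨fun x hx => ?_, fun y => ?_⟩
      · have hE : E (x : X) = 0 := (hi _).mp ⟨x, rfl, by rw [hx, sub_self]⟩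
        exact hinj (by rw [hx, hE, smul_zero, smul_zero, sub_self])
      · obtain ⟨_, x, -, hx⟩ := hs y
        exact ⟨x, hx.symm⟩
  have hker : ((∀ x : ↥dom, A x = lam • E (x : X) → x = 0) ∧
        ∀ y : Y, ∃ x : ↥dom, A x - lam • E (x : X) = y) ↔
      ({x : ↥dom | (x, 0) ∈ kerRepShift E dom A lam} = {0} ∧
        {y : ↥dom | ∃ x : ↥dom, (x, y) ∈ kerRepShift E dom A lam} = Set.univ) := by
    simp only [Set.ext_iff, Set.mem_ofPred_eq, kerRepShift,
      Set.mem_singleton_iff, Set.mem_univ, iff_true, map_add, map_smul,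
      ZeroMemClass.coe_zero, map_zero, zero_add]
    constructor
    · rintro ⟨hi, hs⟩
      refine ⟨fun x => ⟨hi x, ?_⟩, fun y => ?_⟩
      · rintro rfl
        simp
      · obtain ⟨x, hx⟩ := hs (E (y : X))
        exact ⟨x, sub_eq_iff_eq_add.mp hx⟩
    · rintro ⟨hi, hs⟩
      refine ⟨fun x => (hi x).mp, fun y => ?_⟩
      -- correct the approximate solution `T y` by solving with right-hand side in `E (dom A)`
      obtain ⟨z, hz⟩ := hs ((lam - μ) • ⟨T y, hTdom y⟩)
      refine ⟨⟨T y, hTdom y⟩ + z, ?_⟩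
      have hT := sub_eq_iff_eq_add.mp (hT1 y)
      rw [map_add, hz, hT]
      simp only [Submodule.coe_add, Submodule.coe_smul, map_add, map_smul]
      module
  exact ⟨hbij.trans hran, hran.symm.trans hker⟩
end

section
/- Assume condition (torte). Then the following are equivalent: (i) E maps X bijectively onto Y, dom A = X, and A is bounded (there is C ≥ 0 with ‖A x‖ ≤ C ‖x‖ for all x ∈ X); (ii) {A x : x ∈ dom A, E x = 0} = {0} and {E x : x ∈ dom A} = Y; (iii) {x ∈ dom A : E x = 0} = {0} and {T(E x) : x ∈ dom A} = dom A. (Equality of the resolvent sets of the pencil and of its range and kernel representations at the point ∞.) -/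
/-- Under condition (torte), the following are equivalent
(equality of the resolvent sets at `∞`):
(i) `E` maps `X` bijectively onto `Y`, `dom A = X`, and `A` is bounded;
(ii) the multivalued part `{A x : x ∈ dom A, E x = 0}` of `A E⁻¹` is `{0}` and its
domain `{E x : x ∈ dom A}` is all of `Y`;
(iii) `ker E ∩ dom A = {0}` and the domain `{T (E x) : x ∈ dom A}` of `E⁻¹A` is
all of `dom A`. -/
theorem stmt8 {X Y : Type*}
    [NormedAddCommGroup X] [NormedSpace ℂ X] [CompleteSpace X]
    [NormedAddCommGroup Y] [NormedSpace ℂ Y] [CompleteSpace Y]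
    (E : X →L[ℂ] Y) (dom : Submodule ℂ X) (A : ↥dom →ₗ[ℂ] Y)
    (hdense : Dense (dom : Set X))
    (hgraph : IsClosed {p : X × Y | ∃ x : ↥dom, p = ((x : X), A x)})
    (μ : ℂ) (T : Y →L[ℂ] X)
    (hTdom : ∀ y : Y, T y ∈ dom)
    (hT1 : ∀ y : Y, A ⟨T y, hTdom y⟩ - μ • E (T y) = y)
    (hT2 : ∀ x : ↥dom, T (A x - μ • E (x : X)) = (x : X)) :
    ((Function.Bijective E ∧ dom = ⊤ ∧
        ∃ C : ℝ, 0 ≤ C ∧ ∀ x : ↥dom, ‖A x‖ ≤ C * ‖(x : X)‖)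
      ↔ ({y : Y | ∃ x : ↥dom, E (x : X) = 0 ∧ y = A x} = {0} ∧
          {y : Y | ∃ x : ↥dom, y = E (x : X)} = Set.univ)) ∧
    (({y : Y | ∃ x : ↥dom, E (x : X) = 0 ∧ y = A x} = {0} ∧
          {y : Y | ∃ x : ↥dom, y = E (x : X)} = Set.univ)
      ↔ ({x : ↥dom | E (x : X) = 0} = {0} ∧
          {y : ↥dom | ∃ x : ↥dom, (y : X) = T (E (x : X))} = Set.univ)) := by
  have hTinj : Function.Injective T := fun y z h => by
    have hsub : (⟨T y, hTdom y⟩ : ↥dom) = ⟨T z, hTdom z⟩ := Subtype.ext h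
    rw [← hT1 y, ← hT1 z, hsub, h]
  have hker : ∀ x : ↥dom, E (x : X) = 0 → (A x = 0 ↔ x = 0) := fun x hx => by
    refine ⟨fun hA => Subtype.ext ?_, fun h => by simp [h]⟩
    rw [← hT2 x, hA, hx]
    simp
  have hmul : {y : Y | ∃ x : ↥dom, E (x : X) = 0 ∧ y = A x} = {0} ↔
      ∀ x : ↥dom, E (x : X) = 0 → x = 0 := by
    constructor
    · intro h x hx
      have hA : A x ∈ ({0} : Set Y) := h ▸ ⟨x, hx, rfl⟩
      exact (hker x hx).1 hA
    · intro h
      ext y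
      constructor
      · rintro ⟨x, hx, rfl⟩
        exact (hker x hx).2 (h x hx)
      · rintro rfl
        exact ⟨0, by simp, by simp⟩
  have hker' : {x : ↥dom | E (x : X) = 0} = {0} ↔ ∀ x : ↥dom, E (x : X) = 0 → x = 0 := by
    constructor
    · intro h x hx
      have hmem : x ∈ ({0} : Set ↥dom) := h ▸ hx
      exact hmem
    · intro h
      ext x
      refine ⟨h x, ?_⟩
      rintro rfl
      simp
  rw [hmul, hker', Set.eq_univ_iff_forall, Set.eq_univ_iff_forall]
  refine ⟨⟨?_, ?_⟩, and_congr_right fun _ => ⟨?_, ?_⟩⟩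
  · rintro ⟨⟨hinj, hsurj⟩, htop, -⟩
    refine ⟨fun x hx => Subtype.ext (hinj (by simpa using hx)), fun y => ?_⟩
    obtain ⟨x, rfl⟩ := hsurj y
    exact ⟨⟨x, htop ▸ Submodule.mem_top⟩, rfl⟩
  · rintro ⟨hinj, hsurj⟩
    have hker_ET : (E ∘L T).ker = ⊥ := by
      refine LinearMap.ker_eq_bot'.2 fun y hy => hTinj ?_
      have h0 := hinj ⟨T y, hTdom y⟩ hy
      simpa using congrArg Subtype.val h0
    have hrange_ET : (E ∘L T).range = ⊤ := by
      refine LinearMap.range_eq_top.2 fun y => ?_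
      obtain ⟨x, hx⟩ := hsurj y
      refine ⟨A x - μ • E (x : X), ?_⟩
      change E (T _) = y
      rw [hT2, hx]
    let e := ContinuousLinearEquiv.ofBijective (E ∘L T) hker_ET hrange_ET
    let S : Y →L[ℂ] Y := (e.symm : Y →L[ℂ] Y)
    have hS : ∀ y, E (T (S y)) = y := fun y => e.apply_symm_apply y
    have hdom : ∀ x : ↥dom, T (S (E (x : X))) = x := fun x => by
      have h0 := hinj (⟨T (S (E (x : X))), hTdom _⟩ - x) (by simp [hS])
      exact congrArg Subtype.val (sub_eq_zero.1 h0)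
    have hid : ∀ x, T (S (E x)) = x := by
      have hext := Continuous.ext_on hdense (f := fun x => T (S (E x))) (g := id)
        (by fun_prop) continuous_id fun x hx => hdom ⟨x, hx⟩
      exact fun x => congrFun hext x
    refine ⟨⟨Function.LeftInverse.injective (g := fun y => T (S y)) hid,
      fun y => ⟨_, hS y⟩⟩, ?_, ‖S ∘L E + μ • E‖, norm_nonneg _, fun x => ?_⟩
    · exact eq_top_iff.2 fun x _ => hid x ▸ hTdom _
    · have hA : A x = (S ∘L E + μ • E) (x : X) := by
        have hx : A x - μ • E (x : X) = S (E (x : X)) := hTinj ((hT2 x).trans (hid _).symm)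
        simpa using sub_eq_iff_eq_add.1 hx
      rw [hA]
      exact ContinuousLinearMap.le_opNorm _ _
  · intro h x
    obtain ⟨z, hz⟩ := h (A x - μ • E (x : X))
    exact ⟨z, by rw [← hz, hT2]⟩
  · intro h y
    obtain ⟨z, hz⟩ := h ⟨T y, hTdom y⟩
    exact ⟨z, hTinj hz⟩
end

section
/- Assume condition (torte). Then the following are equivalent: (i) E(dom A) is closed in Y, dim(ker E ∩ dom A) < ∞, and dim(Y / E(dom A)) < ∞ (the restriction of E to dom A is a Fredholm operator); (ii) E(dom A) is closed in Y, dim(Y / E(dom A)) < ∞, and dim {A x : x ∈ dom A, E x = 0} < ∞; (iii) the set {(T(E x), A(T(E x))) : x ∈ dom A} is closed in X × Y, the subspace {T(E x) : x ∈ dom A} has finite codimension in dom A, and dim(ker E ∩ dom A) < ∞. (Equality of the essential spectra of the pencil and of its range and kernel representations at the point ∞.) -/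
universe u

/-- Under condition (torte), the following are equivalent
(equality of the essential spectra at `∞`):
(i) `E|_{dom A}` is Fredholm: `E (dom A)` is closed, `dim (ker E ∩ dom A) < ∞` and
`codim E (dom A) < ∞`;
(ii) `E (dom A)` is closed, `codim E (dom A) < ∞`, and the multivalued part
`{A x : x ∈ dom A, E x = 0}` of `A E⁻¹` is finite dimensional;
(iii) the graph `{(T (E x), A (T (E x))) : x ∈ dom A}` is closed in `X × Y`,
the domain `{T (E x) : x ∈ dom A}` of `E⁻¹A` has finite codimension in `dom A`,
and `dim (ker E ∩ dom A) < ∞`. -/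
theorem stmt10 {X Y : Type u}
    [NormedAddCommGroup X] [NormedSpace ℂ X] [CompleteSpace X]
    [NormedAddCommGroup Y] [NormedSpace ℂ Y] [CompleteSpace Y]
    (E : X →L[ℂ] Y) (dom : Submodule ℂ X) (A : ↥dom →ₗ[ℂ] Y)
    (hdense : Dense (dom : Set X))
    (hgraph : IsClosed {p : X × Y | ∃ x : ↥dom, p = ((x : X), A x)})
    (μ : ℂ) (T : Y →L[ℂ] X)
    (hTdom : ∀ y : Y, T y ∈ dom)
    (hT1 : ∀ y : Y, A ⟨T y, hTdom y⟩ - μ • E (T y) = y)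
    (hT2 : ∀ x : ↥dom, T (A x - μ • E (x : X)) = (x : X)) :
    ((IsClosed ((LinearMap.range (E.toLinearMap.comp dom.subtype) : Submodule ℂ Y) : Set Y) ∧
        Module.rank ℂ (LinearMap.ker (E.toLinearMap.comp dom.subtype)) < Cardinal.aleph0 ∧
        Module.rank ℂ (Y ⧸ LinearMap.range (E.toLinearMap.comp dom.subtype)) < Cardinal.aleph0)
      ↔ (IsClosed ((LinearMap.range (E.toLinearMap.comp dom.subtype) : Submodule ℂ Y) : Set Y) ∧
        Module.rank ℂ (Y ⧸ LinearMap.range (E.toLinearMap.comp dom.subtype)) < Cardinal.aleph0 ∧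
        Module.rank ℂ
          (Submodule.map A (LinearMap.ker (E.toLinearMap.comp dom.subtype))) < Cardinal.aleph0)) ∧
    ((IsClosed ((LinearMap.range (E.toLinearMap.comp dom.subtype) : Submodule ℂ Y) : Set Y) ∧
        Module.rank ℂ (Y ⧸ LinearMap.range (E.toLinearMap.comp dom.subtype)) < Cardinal.aleph0 ∧
        Module.rank ℂ
          (Submodule.map A (LinearMap.ker (E.toLinearMap.comp dom.subtype))) < Cardinal.aleph0)
      ↔ (IsClosed {p : X × Y | ∃ x : ↥dom,
            p = (T (E (x : X)), A ⟨T (E (x : X)), hTdom _⟩)} ∧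
        Module.rank ℂ (↥dom ⧸ LinearMap.range (LinearMap.codRestrict dom
            ((T.toLinearMap.comp E.toLinearMap).comp dom.subtype)
            (fun x => hTdom (E (x : X))))) < Cardinal.aleph0 ∧
        Module.rank ℂ (LinearMap.ker (E.toLinearMap.comp dom.subtype)) < Cardinal.aleph0)) := by
  set F : ↥dom →ₗ[ℂ] Y := E.toLinearMap.comp dom.subtype with hF
  let e : Y ≃ₗ[ℂ] ↥dom := LinearEquiv.ofLinearMap
    (LinearMap.codRestrict dom T.toLinearMap hTdom) (A - μ • F)
    (by ext x; exact hT2 x) (by ext y; exact hT1 y)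
  have hAT (y : Y) : A ⟨T y, hTdom y⟩ = y + μ • E (T y) := sub_eq_iff_eq_add.mp (hT1 y)
  have hker : Module.rank ℂ (Submodule.map A (LinearMap.ker F)) =
      Module.rank ℂ (LinearMap.ker F) := by
    have hmap : Submodule.map A (LinearMap.ker F) =
        Submodule.map (e.symm : ↥dom →ₗ[ℂ] Y) (LinearMap.ker F) := by
      refine SetLike.coe_injective (Set.image_congr fun x hx => ?_)
      have hx0 : F x = 0 := hx
      change A x = A x - μ • F x
      rw [hx0, smul_zero, sub_zero]
    rw [hmap]
    exact (e.symm.submoduleMap _).rank_eq.symm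
  have hcodim : Module.rank ℂ (↥dom ⧸ LinearMap.range (LinearMap.codRestrict dom
      ((T.toLinearMap.comp E.toLinearMap).comp dom.subtype)
      (fun x => hTdom (E (x : X))))) = Module.rank ℂ (Y ⧸ LinearMap.range F) := by
    refine (Submodule.Quotient.equiv _ _ e ?_).rank_eq.symm
    exact (LinearMap.range_comp F (e : Y →ₗ[ℂ] ↥dom)).symm
  have hclosed : IsClosed {p : X × Y | ∃ x : ↥dom,
      p = (T (E (x : X)), A ⟨T (E (x : X)), hTdom _⟩)} ↔
      IsClosed (LinearMap.range F : Set Y) := by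
    have hemb : Topology.IsClosedEmbedding fun y : Y => (T y, y + μ • E (T y)) :=
      Function.LeftInverse.isClosedEmbedding (f := fun p : X × Y => p.2 - μ • E p.1)
        (fun y => add_sub_cancel_right y _) (by fun_prop) (by fun_prop)
    rw [hemb.isClosed_iff_image_isClosed]
    refine iff_of_eq (congrArg IsClosed (Set.ext fun p => ?_))
    simp only [hAT, Set.mem_ofPred_eq, Set.mem_image, SetLike.mem_coe, LinearMap.mem_range,
      exists_exists_eq_and]
    exact exists_congr fun x => eq_comm
  rw [hker, hcodim, hclosed]
  tauto
end

section
/- Assume condition (torte). Then for every λ ∈ ℂ and every integer k ≥ 1, R_λ^k(AE^{-1}) = {E x : x ∈ R_λ^k(E^{-1}A)}, and R_∞^k(AE^{-1}) = {A x : x ∈ R_∞^k(E^{-1}A)}. -/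
/-- Root subspace of order `k` at `lam` of a linear relation `L ⊆ V × V`:
elements `x` admitting a chain `z_0 = 0, …, z_k = x` with
`(z_j, z_{j-1} + lam • z_j) ∈ L` for `1 ≤ j ≤ k`. -/
def rootSet {K V : Type*} [Field K] [AddCommGroup V] [Module K V]
    (L : Set (V × V)) (lam : K) (k : ℕ) : Set V :=
  {x | ∃ z : Fin (k + 1) → V, z 0 = 0 ∧ z (Fin.last k) = x ∧
    ∀ j : Fin k, (z j.succ, z j.castSucc + lam • z j.succ) ∈ L}

/-- Root subspace of order `k` at `∞` of a linear relation `L ⊆ V × V`: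
elements `x` admitting a chain `z_0 = 0, …, z_k = x` with `(z_{j-1}, z_j) ∈ L`. -/
def rootInfSet {V : Type*} [AddCommGroup V] (L : Set (V × V)) (k : ℕ) : Set V :=
  {x | ∃ z : Fin (k + 1) → V, z 0 = 0 ∧ z (Fin.last k) = x ∧
    ∀ j : Fin k, (z j.castSucc, z j.succ) ∈ L}

variable {X Y : Type*} [NormedAddCommGroup X] [NormedSpace ℂ X]
  [NormedAddCommGroup Y] [NormedSpace ℂ Y]

/-- The kernel representation `E⁻¹A = {(x, z) ∈ dom A × dom A : A x = E z}`. -/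
def kerRepSet (E : X →L[ℂ] Y) (dom : Submodule ℂ X) (A : ↥dom →ₗ[ℂ] Y) :
    Set (↥dom × ↥dom) :=
  {p | A p.1 = E (p.2 : X)}

/-- The range representation `A E⁻¹ = {(E x, A x) : x ∈ dom A} ⊆ Y × Y`. -/
def ranRepSet (E : X →L[ℂ] Y) (dom : Submodule ℂ X) (A : ↥dom →ₗ[ℂ] Y) :
    Set (Y × Y) :=
  {p | ∃ x : ↥dom, p = (E (x : X), A x)}

/-- The root subspaces at `lam` of the range representation are the images under `E` of those of
the kernel representation; no resolvent point is needed. -/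
theorem rootSet_ranRepSet (E : X →L[ℂ] Y) (dom : Submodule ℂ X) (A : ↥dom →ₗ[ℂ] Y)
    (lam : ℂ) (k : ℕ) :
    rootSet (ranRepSet E dom A) lam k
      = (fun x : ↥dom => E (x : X)) '' rootSet (kerRepSet E dom A) lam k := by
  ext y
  constructor
  · rintro ⟨z, hz0, hzk, hz⟩
    choose x hx using hz
    simp only [Prod.mk.injEq] at hx
    have hw : ∀ j, E ((Fin.cons 0 x : Fin (k + 1) → ↥dom) j : X) = z j := by
      refine Fin.cases ?_ fun j => ?_
      · simp [hz0]
      · simp [(hx j).1]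
    refine ⟨_, ⟨Fin.cons 0 x, Fin.cons_zero _ _, rfl, fun j => ?_⟩, (hw _).trans hzk⟩
    simp only [kerRepSet, Set.mem_ofPred_eq, Submodule.coe_add, Submodule.coe_smul, map_add,
      map_smul, hw]
    simp [(hx j).2]
  · rintro ⟨_, ⟨z, hz0, rfl, hz⟩, rfl⟩
    refine ⟨fun j => E (z j : X), by simp [hz0], rfl, fun j => ⟨z j.succ, ?_⟩⟩
    have h : A (z j.succ) = E ((z j.castSucc + lam • z j.succ : ↥dom) : X) := hz j
    simp [h]

/-- The root subspaces at `∞` of the range representation are the images under `A` of those of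
the kernel representation; no resolvent point is needed. -/
theorem rootInfSet_ranRepSet (E : X →L[ℂ] Y) (dom : Submodule ℂ X) (A : ↥dom →ₗ[ℂ] Y) (k : ℕ) :
    rootInfSet (ranRepSet E dom A) k
      = (fun x : ↥dom => A x) '' rootInfSet (kerRepSet E dom A) k := by
  ext y
  constructor
  · rintro ⟨z, hz0, hzk, hz⟩
    choose x hx using hz
    simp only [Prod.mk.injEq] at hx
    have hw : ∀ j, A ((Fin.cons 0 x : Fin (k + 1) → ↥dom) j) = z j := by
      refine Fin.cases ?_ fun j => ?_
      · simp [hz0]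
      · simp [(hx j).2]
    refine ⟨_, ⟨Fin.cons 0 x, Fin.cons_zero _ _, rfl, fun j => ?_⟩, (hw _).trans hzk⟩
    simp only [kerRepSet, Set.mem_ofPred_eq, hw]
    simp [(hx j).1]
  · rintro ⟨_, ⟨z, hz0, rfl, hz⟩, rfl⟩
    refine ⟨fun j => A (z j), by simp [hz0], rfl, fun j => ⟨z j.succ, ?_⟩⟩
    have h : A (z j.castSucc) = E (z j.succ : X) := hz j
    simp [h]

/-- Under condition (torte), for every `λ ∈ ℂ` and `k ≥ 1`,
`R_λ^k(A E⁻¹) = E (R_λ^k(E⁻¹A))` and `R_∞^k(A E⁻¹) = A (R_∞^k(E⁻¹A))`. -/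
theorem stmt12 {X Y : Type*}
    [NormedAddCommGroup X] [NormedSpace ℂ X] [CompleteSpace X]
    [NormedAddCommGroup Y] [NormedSpace ℂ Y] [CompleteSpace Y]
    (E : X →L[ℂ] Y) (dom : Submodule ℂ X) (A : ↥dom →ₗ[ℂ] Y)
    (hdense : Dense (dom : Set X))
    (hgraph : IsClosed {p : X × Y | ∃ x : ↥dom, p = ((x : X), A x)})
    (μ : ℂ) (T : Y →L[ℂ] X)
    (hTdom : ∀ y : Y, T y ∈ dom)
    (hT1 : ∀ y : Y, A ⟨T y, hTdom y⟩ - μ • E (T y) = y)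
    (hT2 : ∀ x : ↥dom, T (A x - μ • E (x : X)) = (x : X)) :
    ∀ (lam : ℂ) (k : ℕ), 1 ≤ k →
      rootSet (ranRepSet E dom A) lam k
        = (fun x : ↥dom => E (x : X)) '' rootSet (kerRepSet E dom A) lam k ∧
      rootInfSet (ranRepSet E dom A) k
        = (fun x : ↥dom => A x) '' rootInfSet (kerRepSet E dom A) k := by
  exact fun lam k _ =>
    ⟨rootSet_ranRepSet E dom A lam k, rootInfSet_ranRepSet E dom A k⟩
end

section
/- Assume condition (torte). Then for every λ ∈ ℂ and every integer k ≥ 1, R_λ^k(E,A) ∩ {x ∈ dom A : E x = 0} = {0} (E is injective on each root subspace of the pencil at λ), and R_∞^k(E,A) ∩ {x ∈ dom A : A x = 0} = {0} (A is injective on each root subspace of the pencil at ∞). -/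
variable {X Y : Type*} [NormedAddCommGroup X] [NormedSpace ℂ X]
  [NormedAddCommGroup Y] [NormedSpace ℂ Y]

/-- Root subspace `R_lam^k(E,A)` of the pencil `λ E - A` at `lam ∈ ℂ`: Jordan chains
`x_1, …, x_k` (with `x_0 = 0`) satisfying `A x_j - lam E x_j = E x_{j-1}`. -/
def pencilRootSet (E : X →L[ℂ] Y) (dom : Submodule ℂ X) (A : ↥dom →ₗ[ℂ] Y)
    (lam : ℂ) (k : ℕ) : Set ↥dom :=
  {x | ∃ z : Fin (k + 1) → ↥dom, z 0 = 0 ∧ z (Fin.last k) = x ∧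
    ∀ j : Fin k, A (z j.succ) - lam • E (z j.succ : X) = E (z j.castSucc : X)}

/-- Root subspace `R_∞^k(E,A)` of the pencil `λ E - A` at `∞`: Jordan chains
`x_1, …, x_k` (with `x_0 = 0`) satisfying `E x_j = A x_{j-1}`. -/
def pencilRootInfSet (E : X →L[ℂ] Y) (dom : Submodule ℂ X) (A : ↥dom →ₗ[ℂ] Y)
    (k : ℕ) : Set ↥dom :=
  {x | ∃ z : Fin (k + 1) → ↥dom, z 0 = 0 ∧ z (Fin.last k) = x ∧
    ∀ j : Fin k, E (z j.succ : X) = A (z j.castSucc)}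

/-- A chain `P x_{j+1} = Q x_j` of commuting endomorphisms starting at `x_0 = 0` satisfies
`P ^ k x_k = 0`. -/
theorem Module.End.pow_apply_chain_eq_zero {R M : Type*} [Semiring R] [AddCommMonoid M]
    [Module R M] {P Q : Module.End R M} (hPQ : Commute P Q) {k : ℕ} (z : Fin (k + 1) → M)
    (h0 : z 0 = 0) (hz : ∀ j : Fin k, P (z j.succ) = Q (z j.castSucc)) :
    (P ^ k) (z (Fin.last k)) = 0 := by
  suffices h : ∀ j : Fin (k + 1), (P ^ (j : ℕ)) (z j) = 0 from h (Fin.last k)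
  intro j
  induction j using Fin.induction with
  | zero => simp [h0]
  | succ j ih =>
    have hc : (P ^ (j : ℕ)) (Q (z j.castSucc)) = Q ((P ^ (j : ℕ)) (z j.castSucc)) :=
      LinearMap.congr_fun (hPQ.pow_left j).eq _
    rw [Fin.val_castSucc] at ih
    rw [Fin.val_succ, pow_succ, Module.End.mul_apply, hz, hc, ih, map_zero]

/-- A fixed point of `f` is a fixed point of `f ^ n`. -/
theorem Module.End.pow_apply_eq_self {R M : Type*} [Semiring R] [AddCommMonoid M]
    [Module R M] {f : Module.End R M} {x : M} (h : f x = x) (n : ℕ) : (f ^ n) x = x := by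
  rw [Module.End.pow_apply]
  exact Function.iterate_fixed h n

/-- Under condition (torte), for every `λ ∈ ℂ` and `k ≥ 1`,
`E` is injective on the root subspace of the pencil at `λ`:
`R_λ^k(E,A) ∩ (ker E ∩ dom A) = {0}`, and `A` is injective on the root subspace at
`∞`: `R_∞^k(E,A) ∩ (ker A) = {0}`. -/
theorem stmt14 {X Y : Type*}
    [NormedAddCommGroup X] [NormedSpace ℂ X] [CompleteSpace X]
    [NormedAddCommGroup Y] [NormedSpace ℂ Y] [CompleteSpace Y]
    (E : X →L[ℂ] Y) (dom : Submodule ℂ X) (A : ↥dom →ₗ[ℂ] Y)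
    (hdense : Dense (dom : Set X))
    (hgraph : IsClosed {p : X × Y | ∃ x : ↥dom, p = ((x : X), A x)})
    (μ : ℂ) (T : Y →L[ℂ] X)
    (hTdom : ∀ y : Y, T y ∈ dom)
    (hT1 : ∀ y : Y, A ⟨T y, hTdom y⟩ - μ • E (T y) = y)
    (hT2 : ∀ x : ↥dom, T (A x - μ • E (x : X)) = (x : X)) :
    ∀ (lam : ℂ) (k : ℕ), 1 ≤ k →
      pencilRootSet E dom A lam k ∩ {x : ↥dom | E (x : X) = 0} = {0} ∧
      pencilRootInfSet E dom A k ∩ {x : ↥dom | A x = 0} = {0} := by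
  intro lam k _
  let S : Module.End ℂ X := (T ∘L E : X →L[ℂ] X)
  have hS (x : X) : S x = T (E x) := rfl
  have hTA (x : dom) : T (A x) = x + μ • S x := by
    have h := hT2 x
    rw [map_sub, map_smul, sub_eq_iff_eq_add] at h
    exact h
  constructor
  · refine Set.Subset.antisymm ?_ ?_
    · rintro x ⟨⟨z, h0, rfl, hz⟩, hE : E _ = 0⟩
      have hcomm : Commute (1 - (lam - μ) • S) S :=
        (Commute.one_left S).sub_left ((Commute.refl S).smul_left _)
      have hpow := Module.End.pow_apply_chain_eq_zero hcomm (fun j => (z j : X)) (by simp [h0])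
        fun j => by
          have h := congrArg T (hz j)
          rw [map_sub, map_smul, hTA, ← hS, ← hS] at h
          rw [← h, LinearMap.sub_apply, LinearMap.smul_apply, Module.End.one_apply]
          module
      rw [Module.End.pow_apply_eq_self (by simp [hS, hE])] at hpow
      exact Subtype.ext hpow
    · rintro _ rfl
      exact ⟨⟨0, rfl, rfl, by simp⟩, by simp⟩
  · refine Set.Subset.antisymm ?_ ?_
    · rintro x ⟨⟨z, h0, rfl, hz⟩, hA : A _ = 0⟩
      have hcomm : Commute S (1 + μ • S) :=
        (Commute.one_right S).add_right ((Commute.refl S).smul_right _)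
      have hpow := Module.End.pow_apply_chain_eq_zero hcomm (fun j => (z j : X)) (by simp [h0])
        fun j => by
          rw [hS, hz j, hTA]
          simp
      have hfix : ((-μ) • S) (z (Fin.last k) : X) = z (Fin.last k) := by
        have h := hTA (z (Fin.last k))
        rw [hA, map_zero] at h
        rw [LinearMap.smul_apply, neg_smul]
        exact (eq_neg_of_add_eq_zero_left h.symm).symm
      have h := Module.End.pow_apply_eq_self hfix k
      rw [smul_pow, LinearMap.smul_apply, hpow, smul_zero] at h
      exact Subtype.ext h.symm
    · rintro _ rfl
      exact ⟨⟨0, rfl, rfl, by simp⟩, by simp⟩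
end

section
/- Assume condition (torte). Let u ∈ Y and let v', w' : X → ℂ be continuous linear functionals. Set L := {(x, z) ∈ dom A × dom A : A x = E z} and M := {(x, z) ∈ dom A × dom A : A x + w'(x) u = E z + v'(z) u}. Then dim(L / (L ∩ M)) ≤ 1 and dim(M / (L ∩ M)) ≤ 1; that is, the kernel representations of the pencils λE − A and λ(E + u v') − (A + u w') are one-dimensional perturbations of each other. -/
variable {X Y : Type*} [NormedAddCommGroup X] [NormedSpace ℂ X]
  [NormedAddCommGroup Y] [NormedSpace ℂ Y]

/-- The kernel representation `E⁻¹A = {(x, z) ∈ dom A × dom A : A x = E z}`. -/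
def kerRepSub (E : X →L[ℂ] Y) (dom : Submodule ℂ X) (A : ↥dom →ₗ[ℂ] Y) :
    Submodule ℂ (↥dom × ↥dom) where
  carrier := {p | A p.1 = E (p.2 : X)}
  zero_mem' := by simp
  add_mem' := by
    intro p q hp hq
    simp only [Set.mem_setOf_eq] at *
    simp only [Prod.fst_add, Prod.snd_add, Submodule.coe_add, map_add, hp, hq]
  smul_mem' := by
    intro c p hp
    simp only [Set.mem_setOf_eq] at *
    simp only [Prod.smul_fst, Prod.smul_snd, Submodule.coe_smul, map_smul, hp]

/-- The kernel representation of the rank-one perturbed pencil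
`λ(E + u v') - (A + u w')`:
the set `{(x, z) ∈ dom A × dom A : A x + w'(x) u = E z + v'(z) u}`. -/
def kerRepSubPert (E : X →L[ℂ] Y) (dom : Submodule ℂ X) (A : ↥dom →ₗ[ℂ] Y)
    (u : Y) (v' w' : X →L[ℂ] ℂ) : Submodule ℂ (↥dom × ↥dom) where
  carrier := {p | A p.1 + w' (p.1 : X) • u = E (p.2 : X) + v' (p.2 : X) • u}
  zero_mem' := by simp
  add_mem' := by
    intro p q hp hq
    simp only [Set.mem_setOf_eq] at *
    simp only [Prod.fst_add, Prod.snd_add, Submodule.coe_add, map_add, add_smul]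
    calc A p.1 + A q.1 + (w' ↑p.1 • u + w' ↑q.1 • u)
        = (A p.1 + w' ↑p.1 • u) + (A q.1 + w' ↑q.1 • u) := by abel
      _ = (E ↑p.2 + v' ↑p.2 • u) + (E ↑q.2 + v' ↑q.2 • u) := by rw [hp, hq]
      _ = E ↑p.2 + E ↑q.2 + (v' ↑p.2 • u + v' ↑q.2 • u) := by abel
  smul_mem' := by
    intro c p hp
    simp only [Set.mem_setOf_eq] at *
    simp only [Prod.smul_fst, Prod.smul_snd, Submodule.coe_smul, map_smul, smul_assoc,
      ← smul_add, hp]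

/-- The quotient of a vector space by a subspace containing the kernel of a linear functional
has rank at most one. -/
theorem rank_quotient_le_one_of_ker_le {K V : Type*} [Field K] [AddCommGroup V] [Module K V]
    (f : V →ₗ[K] K) (S : Submodule K V) (h : LinearMap.ker f ≤ S) :
    Module.rank K (V ⧸ S) ≤ 1 := by
  have hker : Module.rank K (V ⧸ LinearMap.ker f) ≤ 1 := by
    rw [← Cardinal.lift_le_one_iff, f.quotKerEquivRange.lift_rank_eq, Cardinal.lift_le_one_iff]
    exact (Submodule.rank_le _).trans_eq (Module.rank_self K)
  exact (LinearMap.rank_le_of_surjective _ (Submodule.factor_surjective h)).trans hker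

/-- Under condition (torte), for `u ∈ Y` and continuous linear
functionals `v', w'` on `X`, the kernel representations of `λ E - A` and of
`λ(E + u v') - (A + u w')` are one-dimensional perturbations of each other. -/
theorem stmt17 {X Y : Type*}
    [NormedAddCommGroup X] [NormedSpace ℂ X] [CompleteSpace X]
    [NormedAddCommGroup Y] [NormedSpace ℂ Y] [CompleteSpace Y]
    (E : X →L[ℂ] Y) (dom : Submodule ℂ X) (A : ↥dom →ₗ[ℂ] Y)
    (hdense : Dense (dom : Set X))
    (hgraph : IsClosed {p : X × Y | ∃ x : ↥dom, p = ((x : X), A x)})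
    (μ : ℂ) (T : Y →L[ℂ] X)
    (hTdom : ∀ y : Y, T y ∈ dom)
    (hT1 : ∀ y : Y, A ⟨T y, hTdom y⟩ - μ • E (T y) = y)
    (hT2 : ∀ x : ↥dom, T (A x - μ • E (x : X)) = (x : X))
    (u : Y) (v' w' : X →L[ℂ] ℂ) :
    Module.rank ℂ (↥(kerRepSub E dom A) ⧸
        (kerRepSub E dom A ⊓ kerRepSubPert E dom A u v' w').comap
          (kerRepSub E dom A).subtype) ≤ 1 ∧
    Module.rank ℂ (↥(kerRepSubPert E dom A u v' w') ⧸
        (kerRepSub E dom A ⊓ kerRepSubPert E dom A u v' w').comap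
          (kerRepSubPert E dom A u v' w').subtype) ≤ 1 := by
  let f : ↥dom × ↥dom →ₗ[ℂ] ℂ :=
    w'.toLinearMap ∘ₗ dom.subtype ∘ₗ LinearMap.fst ℂ dom dom -
      v'.toLinearMap ∘ₗ dom.subtype ∘ₗ LinearMap.snd ℂ dom dom
  have hf (p : ↥dom × ↥dom) (hp : f p = 0) : w' (p.1 : X) = v' (p.2 : X) :=
    sub_eq_zero.mp hp
  have mem_iff (p : ↥dom × ↥dom) (hp : f p = 0) :
      p ∈ kerRepSub E dom A ↔ p ∈ kerRepSubPert E dom A u v' w' := by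
    change A p.1 = E p.2 ↔ A p.1 + w' (p.1 : X) • u = E p.2 + v' (p.2 : X) • u
    rw [hf p hp, add_left_inj]
  exact ⟨rank_quotient_le_one_of_ker_le (f ∘ₗ (kerRepSub E dom A).subtype) _
      fun p hp => ⟨p.2, (mem_iff p hp).mp p.2⟩,
    rank_quotient_le_one_of_ker_le (f ∘ₗ (kerRepSubPert E dom A u v' w').subtype) _
      fun p hp => ⟨(mem_iff p hp).mpr p.2, p.2⟩⟩
end

section
/- Let the pencil λE − A satisfy condition (torte). Let u, w ∈ Y, let v' : X → ℂ be a continuous linear functional, and define Ê x := E x + v'(x) u for x ∈ X and Â x := A x + v'(x) w for x ∈ dom Â := dom A. Assume that the perturbed pencil λÊ − Â also satisfies condition (torte) (i.e., there exist μ̂ ∈ ℂ and a bounded operator T̂ : Y → X with T̂ y ∈ dom A, (Â − μ̂ Ê)(T̂ y) = y for all y ∈ Y, and T̂((Â − μ̂ Ê) x) = x for all x ∈ dom A). Let λ ∈ ℂ or λ = ∞ and let k ≥ 1 be an integer such that w_k(E,A;λ) is finite. Then w_k(Ê,Â;λ) is finite and |w_k(Ê,Â;λ) − w_k(E,A;λ)|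 ≤ 1, i.e., w_k(Ê,Â;λ) ≤ w_k(E,A;λ) + 1 and w_k(E,A;λ) ≤ w_k(Ê,Â;λ) + 1. Moreover, if dim R_λ^k(E,A) is finite, then |dim R_λ^k(Ê,Â) − dim R_λ^k(E,A)| ≤ k. -/
variable {X Y : Type*} [NormedAddCommGroup X] [NormedSpace ℂ X]
  [NormedAddCommGroup Y] [NormedSpace ℂ Y]
  (E : X →L[ℂ] Y) (dom : Submodule ℂ X) (A : ↥dom →ₗ[ℂ] Y)

/-- Root subspace of order `k` of the pencil `λ E - A` at `lam ∈ ℂ`. -/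
def pencilRoot (lam : ℂ) (k : ℕ) : Submodule ℂ ↥dom where
  carrier := {x | ∃ z : Fin (k + 1) → ↥dom, z 0 = 0 ∧ z (Fin.last k) = x ∧
    ∀ j : Fin k, A (z j.succ) - lam • E (z j.succ : X) = E (z j.castSucc : X)}
  zero_mem' := ⟨fun _ => 0, rfl, rfl, fun _ => by simp⟩
  add_mem' := by
    rintro a b ⟨z, hz0, hzl, hzm⟩ ⟨w, hw0, hwl, hwm⟩
    refine ⟨z + w, by simp [hz0, hw0], by simp [hzl, hwl], fun j => ?_⟩
    have := congrArg₂ (· + ·) (hzm j) (hwm j)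
    simp only [Pi.add_apply, Submodule.coe_add, map_add, smul_add] at *
    rw [← this]; abel
  smul_mem' := by
    rintro c x ⟨z, hz0, hzl, hzm⟩
    refine ⟨c • z, by simp [hz0], by simp [hzl], fun j => ?_⟩
    have := congrArg (c • ·) (hzm j)
    simp only [Pi.smul_apply, Submodule.coe_smul, map_smul, smul_sub,
      smul_comm c lam] at *
    exact this

/-- Root subspace of order `k` of the pencil `λ E - A` at `∞`. -/
def pencilRootInf (k : ℕ) : Submodule ℂ ↥dom where
  carrier := {x | ∃ z : Fin (k + 1) → ↥dom, z 0 = 0 ∧ z (Fin.last k) = x ∧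
    ∀ j : Fin k, E (z j.succ : X) = A (z j.castSucc)}
  zero_mem' := ⟨fun _ => 0, rfl, rfl, fun _ => by simp⟩
  add_mem' := by
    rintro a b ⟨z, hz0, hzl, hzm⟩ ⟨w, hw0, hwl, hwm⟩
    refine ⟨z + w, by simp [hz0, hw0], by simp [hzl, hwl], fun j => ?_⟩
    have := congrArg₂ (· + ·) (hzm j) (hwm j)
    simpa [map_add] using this
  smul_mem' := by
    rintro c x ⟨z, hz0, hzl, hzm⟩
    refine ⟨c • z, by simp [hz0], by simp [hzl], fun j => ?_⟩
    have := congrArg (c • ·) (hzm j)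
    simpa [map_smul] using this

/-- The Weyr characteristic `w_k(E,A;λ)` of the pencil `λ E - A`, where `some l`
denotes a finite eigenvalue `l ∈ ℂ` and `none` denotes `λ = ∞`:
`w_k = dim (R_λ^k(E,A) / R_λ^{k-1}(E,A))`. -/
noncomputable def weyr (lam : Option ℂ) (k : ℕ) : Cardinal :=
  match lam with
  | some l => Module.rank ℂ (↥(pencilRoot E dom A l k) ⧸
      (pencilRoot E dom A l (k - 1)).comap (pencilRoot E dom A l k).subtype)
  | none => Module.rank ℂ (↥(pencilRootInf E dom A k) ⧸
      (pencilRootInf E dom A (k - 1)).comap (pencilRootInf E dom A k).subtype)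

/-- The dimension of the root subspace `R_λ^k(E,A)` (`none` denotes `λ = ∞`). -/
noncomputable def rootDim (lam : Option ℂ) (k : ℕ) : Cardinal :=
  match lam with
  | some l => Module.rank ℂ (pencilRoot E dom A l k)
  | none => Module.rank ℂ (pencilRootInf E dom A k)

section ChainSubspaces

variable {K V W Z : Type*} [Field K] [AddCommGroup V] [Module K V] [AddCommGroup W] [Module K W]
  [AddCommGroup Z] [Module K Z]

/-- `x` restricted to `{0, …, k}` is a chain of length `k` of the pair `(F, G)`, starting at `0`. -/
def IsPairChain (F G : V →ₗ[K] W) (k : ℕ) (x : ℕ → V) : Prop :=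
  x 0 = 0 ∧ ∀ j < k, G (x (j + 1)) = F (x j)

namespace IsPairChain

variable {F G : V →ₗ[K] W} {k : ℕ} {x y : ℕ → V}

lemma add (hx : IsPairChain F G k x) (hy : IsPairChain F G k y) :
    IsPairChain F G k (fun j => x j + y j) :=
  ⟨by simp [hx.1, hy.1], fun j hj => by simp [hx.2 j hj, hy.2 j hj]⟩

lemma smul (c : K) (hx : IsPairChain F G k x) : IsPairChain F G k (fun j => c • x j) :=
  ⟨by simp [hx.1], fun j hj => by simp [hx.2 j hj]⟩

lemma sub (hx : IsPairChain F G k x) (hy : IsPairChain F G k y) :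
    IsPairChain F G k (fun j => x j - y j) :=
  ⟨by simp [hx.1, hy.1], fun j hj => by simp [hx.2 j hj, hy.2 j hj]⟩

lemma mono {n : ℕ} (hn : n ≤ k) (hx : IsPairChain F G k x) : IsPairChain F G n x :=
  ⟨hx.1, fun j hj => hx.2 j (hj.trans_le hn)⟩

/-- Delaying a chain by `s` steps. -/
lemma delay {n : ℕ} (s : ℕ) (hn : n ≤ k + s) (hx : IsPairChain F G k x) :
    IsPairChain F G n (fun j => x (j - s)) := by
  refine ⟨by simp [hx.1], fun j hj => ?_⟩
  rcases lt_or_ge j s with h | h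
  · have h1 : j + 1 - s = 0 := by omega
    have h2 : j - s = 0 := by omega
    simp [h1, h2, hx.1]
  · have h1 : j + 1 - s = j - s + 1 := by omega
    simpa only [h1] using hx.2 (j - s) (by omega)

/-- If some combination of `F` and `G` has a left inverse, `F` is injective on chain subspaces. -/
lemma eq_zero_of_left_inverse (L : W →ₗ[K] V) (a b : K)
    (hL : ∀ z, L (a • F z + b • G z) = z) (hx : IsPairChain F G k x) (h0 : F (x k) = 0) :
    x k = 0 := by
  set Q : Module.End K V := L ∘ₗ F
  set R : Module.End K V := L ∘ₗ G
  have hQR : a • Q + b • R = 1 := by ext z; simpa [Q, R] using hL z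
  have hstep : ∀ j < k, R (x (j + 1)) = Q (x j) := fun j hj => congrArg L (hx.2 j hj)
  have hone : ∀ z, a • Q z + b • R z = z := fun z => by
    simpa using LinearMap.congr_fun hQR z
  have hcomm : ∀ z, Q (R z) = R (Q z) := by
    by_cases hb : b = 0
    · have hid : ∀ z, a • Q z = z := by simpa [hb] using hone
      have ha : a ≠ 0 ∨ ∀ z : V, z = 0 := by
        by_cases ha : a = 0
        · right; intro z; rw [← hid z, ha, zero_smul]
        · exact Or.inl ha
      intro z
      rcases ha with ha | ha
      · apply smul_right_injective V ha
        change a • Q (R z) = a • R (Q z)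
        rw [hid, ← map_smul, hid]
      · rw [ha (Q (R z)), ha (R (Q z))]
    · intro z
      apply smul_right_injective V hb
      change b • Q (R z) = b • R (Q z)
      have h1 := congrArg Q (hone z)
      have h2 := hone (Q z)
      rw [map_add, map_smul, map_smul] at h1
      exact add_left_cancel (h1.trans h2.symm)
  have hpow : ∀ n ≤ k, (R ^ n) (x k) = (Q ^ n) (x (k - n)) := by
    intro n
    induction n with
    | zero => simp
    | succ n ih =>
      intro hn
      have hC : Commute R (Q ^ n) :=
        Commute.pow_right (LinearMap.ext fun z => (hcomm z).symm : R * Q = Q * R) n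
      have hk : k - n = k - (n + 1) + 1 := by omega
      rw [pow_succ', Module.End.mul_apply, ih (by omega), ← Module.End.mul_apply, hC.eq,
        Module.End.mul_apply, hk, hstep _ (by omega), ← Module.End.mul_apply, ← pow_succ]
  have hQ0 : Q (x k) = 0 := by simp [Q, h0]
  have hb : ∀ n, x k = b ^ n • (R ^ n) (x k) := by
    intro n
    induction n with
    | zero => simp
    | succ n ih =>
      have h1 : x k = b • R (x k) := by simpa [hQ0] using (hone (x k)).symm
      conv_lhs => rw [ih, h1, map_smul]
      rw [smul_smul, ← pow_succ, ← Module.End.mul_apply, ← pow_succ]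
  rw [hb k, hpow k le_rfl, Nat.sub_self, hx.1, map_zero, smul_zero]

end IsPairChain

/-- The subspace of end points of chains of length `k` of the pair `(F, G)`. -/
def chainSubspace (F G : V →ₗ[K] W) (k : ℕ) : Submodule K V where
  carrier := {v | ∃ x, IsPairChain F G k x ∧ x k = v}
  zero_mem' := ⟨fun _ => 0, ⟨rfl, by simp⟩, rfl⟩
  add_mem' := by
    rintro _ _ ⟨x, hx, rfl⟩ ⟨y, hy, rfl⟩
    exact ⟨_, hx.add hy, rfl⟩
  smul_mem' := by
    rintro c _ ⟨x, hx, rfl⟩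
    exact ⟨_, hx.smul c, rfl⟩

lemma mem_chainSubspace {F G : V →ₗ[K] W} {k : ℕ} {v : V} :
    v ∈ chainSubspace F G k ↔ ∃ x, IsPairChain F G k x ∧ x k = v := Iff.rfl

lemma mem_chainSubspace_iff_fin {F G : V →ₗ[K] W} {k : ℕ} {v : V} :
    v ∈ chainSubspace F G k ↔ ∃ z : Fin (k + 1) → V, z 0 = 0 ∧ z (Fin.last k) = v ∧
      ∀ j : Fin k, G (z j.succ) = F (z j.castSucc) := by
  rw [mem_chainSubspace]
  constructor
  · rintro ⟨x, hx, rfl⟩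
    exact ⟨fun i => x i, hx.1, rfl, fun j => hx.2 j j.2⟩
  · rintro ⟨z, h0, rfl, hz⟩
    refine ⟨fun i => if h : i < k + 1 then z ⟨i, h⟩ else 0, ⟨by simpa using h0, fun j hj => ?_⟩, ?_⟩
    · simpa [hj, Nat.lt_succ_of_lt hj] using hz ⟨j, hj⟩
    · simp [Fin.last]

/-- Chains of `(F.prod 0, G.prod v)` are the chains of `(F, G)` lying in `ker v`. -/
lemma isPairChain_prod {F G : V →ₗ[K] W} {v : V →ₗ[K] Z} {k : ℕ} {x : ℕ → V} :
    IsPairChain (F.prod (0 : V →ₗ[K] Z)) (G.prod v) k x ↔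
      IsPairChain F G k x ∧ ∀ j ≤ k, v (x j) = 0 := by
  constructor
  · intro h
    refine ⟨⟨h.1, fun j hj => congrArg Prod.fst (h.2 j hj)⟩, fun j hj => ?_⟩
    cases j with
    | zero => simp [h.1]
    | succ j => exact congrArg Prod.snd (h.2 j hj)
  · rintro ⟨h, hv⟩
    exact ⟨h.1, fun j hj => Prod.ext (h.2 j hj) (hv (j + 1) hj)⟩

lemma chainSubspace_prod_le (F G : V →ₗ[K] W) (v : V →ₗ[K] Z) (k : ℕ) :
    chainSubspace (F.prod (0 : V →ₗ[K] Z)) (G.prod v) k ≤ chainSubspace F G k := by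
  rintro _ ⟨x, hx, rfl⟩
  exact ⟨x, (isPairChain_prod.1 hx).1, rfl⟩

/-- Every chain is a chain in the kernel of the functional `v` up to delays of a single chain. -/
lemma exists_chain_chainSubspace_le (F G : V →ₗ[K] W) (v : V →ₗ[K] K) (k : ℕ) :
    ∃ z, IsPairChain F G k z ∧ chainSubspace F G k ≤
      chainSubspace (F.prod (0 : V →ₗ[K] K)) (G.prod v) k ⊔
        Submodule.span K (Set.range fun i : Fin k => z (i + 1)) := by
  classical
  by_cases hex : ∃ l, ∃ z, IsPairChain F G k z ∧ l ≤ k ∧ v (z l) ≠ 0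
  · obtain ⟨z, hz, hlk, hvz⟩ := Nat.find_spec hex
    have hmin : ∀ j < Nat.find hex, ∀ x, IsPairChain F G k x → v (x j) = 0 := by
      intro j hj x hx
      by_contra h
      exact Nat.find_min hex hj ⟨x, hx, by omega, h⟩
    set l := Nat.find hex
    set S := Submodule.span K (Set.range fun i : Fin k => z (i + 1))
    have hzS : ∀ j ≤ k, z j ∈ S := by
      intro j hj
      cases j with
      | zero => rw [hz.1]; exact S.zero_mem
      | succ j => exact Submodule.subset_span ⟨⟨j, hj⟩, rfl⟩
    refine ⟨z, hz, ?_⟩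
    rintro _ ⟨x, hx, rfl⟩
    have key : ∀ n, ∃ y, IsPairChain F G k y ∧ (∀ j < l + n, v (y j) = 0) ∧ x k - y k ∈ S := by
      intro n
      induction n with
      | zero => exact ⟨x, hx, fun j hj => hmin j hj x hx, by simp⟩
      | succ n ih =>
        obtain ⟨y, hy, hvy, hyS⟩ := ih
        refine ⟨_, hy.sub ((hz.delay n (Nat.le_add_right k n)).smul (v (y (l + n)) / v (z l))),
          fun j hj => ?_, ?_⟩
        · obtain h | rfl : j < l + n ∨ j = l + n := by omega
          · have h1 : v (z (j - n)) = 0 := by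
              by_cases hl : j - n < l
              · exact hmin _ hl z hz
              · have : j - n = 0 := by omega
                rw [this, hz.1, map_zero]
            simp [hvy j h, h1]
          · simp [hvz]
        · have h1 := S.add_mem hyS (S.smul_mem (v (y (l + n)) / v (z l)) (hzS (k - n) (by omega)))
          convert h1 using 1
          abel
    obtain ⟨y, hy, hvy, hyS⟩ := key (k + 1)
    rw [← add_sub_cancel (y k) (x k)]
    exact Submodule.add_mem_sup
      ⟨y, isPairChain_prod.2 ⟨hy, fun j hj => hvy j (by omega)⟩, rfl⟩ hyS
  · push Not at hex
    refine ⟨fun _ => 0, ⟨rfl, by simp⟩, le_sup_of_le_left ?_⟩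
    rintro _ ⟨x, hx, rfl⟩
    exact ⟨x, isPairChain_prod.2 ⟨hx, fun j hj => hex j x hx hj⟩, rfl⟩

/-- If `F` is injective on chain subspaces, the end point of a chain in `ker v` which ends some
shorter chain also ends a shorter chain in `ker v`. -/
lemma chainSubspace_prod_inf_le {F G : V →ₗ[K] W} (v : V →ₗ[K] Z)
    (hF : ∀ k x, IsPairChain F G k x → F (x k) = 0 → x k = 0) (k : ℕ) :
    chainSubspace (F.prod (0 : V →ₗ[K] Z)) (G.prod v) (k + 1) ⊓ chainSubspace F G k ≤
      chainSubspace (F.prod (0 : V →ₗ[K] Z)) (G.prod v) k := by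
  rintro _ ⟨⟨y, hy, rfl⟩, ⟨z, hz, hzy⟩⟩
  have hd := (isPairChain_prod.1 hy).1.sub (hz.delay 1 le_rfl)
  have key : ∀ i ≤ k, y (k + 1 - i) - z (k + 1 - i - 1) = 0 := by
    intro i
    induction i with
    | zero => simp [hzy]
    | succ i ih =>
      intro hi
      have h1 : k + 1 - i = k + 1 - (i + 1) + 1 := by omega
      refine hF _ _ (hd.mono (Nat.sub_le _ _)) ?_
      rw [← hd.2 _ (by omega)]
      simp only [← h1]
      rw [ih (by omega), map_zero]
  have h1 := key k le_rfl
  simp only [Nat.add_sub_cancel_left, Nat.sub_self, hz.1, sub_zero] at h1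
  exact ⟨fun j => y (j + 1), ⟨h1, fun j hj => hy.2 (j + 1) (by omega)⟩, rfl⟩

/-- A rank-one perturbation along `v` does not affect chains in `ker v`. -/
lemma chainSubspace_prod_congr {F G F' G' : V →ₗ[K] W} {v : V →ₗ[K] K} {f g : W}
    (hF : ∀ x, F' x = F x + v x • f) (hG : ∀ x, G' x = G x + v x • g) (k : ℕ) :
    chainSubspace (F'.prod (0 : V →ₗ[K] K)) (G'.prod v) k =
      chainSubspace (F.prod (0 : V →ₗ[K] K)) (G.prod v) k := by
  ext a
  refine exists_congr fun x => and_congr_left fun _ => ?_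
  rw [isPairChain_prod, isPairChain_prod]
  refine and_congr_left fun hv => and_congr_right fun _ => forall₂_congr fun j hj => ?_
  rw [hF, hG, hv j hj.le, hv (j + 1) hj]
  simp

end ChainSubspaces

section RankBounds

variable {K : Type*} {V : Type*} {W : Type*} [Field K] [AddCommGroup V] [Module K V]
  [AddCommGroup W] [Module K W]

lemma rank_quotient_comap_subtype (P P' : Submodule K V) :
    Module.rank K (↥P ⧸ P'.comap P.subtype) = Module.rank K (P.map P'.mkQ) := by
  have h := (P'.mkQ ∘ₗ P.subtype).quotKerEquivRange.rank_eq
  rwa [LinearMap.ker_comp, Submodule.ker_mkQ, LinearMap.range_comp, Submodule.range_subtype] at h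

lemma rank_quotient_le_add_one {P P' Q Q' N : Submodule K V} {c : V} (hNQ : N ≤ Q)
    (hN : N ⊓ Q' ≤ P') (hP : P ≤ N ⊔ P' ⊔ Submodule.span K {c}) :
    Module.rank K (↥P ⧸ P'.comap P.subtype) ≤ Module.rank K (↥Q ⧸ Q'.comap Q.subtype) + 1 := by
  have h1 : P.map P'.mkQ ≤ N.map P'.mkQ ⊔ Submodule.span K {P'.mkQ c} := by
    refine (Submodule.map_mono hP).trans ?_
    rw [Submodule.map_sup, Submodule.map_sup, Submodule.map_span, Set.image_singleton,
      Submodule.mkQ_map_self, sup_bot_eq]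
  have h2 : Module.rank K (N.map P'.mkQ) ≤ Module.rank K (N.map Q'.mkQ) := by
    rw [← rank_quotient_comap_subtype, ← rank_quotient_comap_subtype]
    have hle : Q'.comap N.subtype ≤ P'.comap N.subtype := fun x hx => hN ⟨x.2, hx⟩
    exact LinearMap.rank_le_of_surjective (Submodule.factor hle) (Submodule.factor_surjective hle)
  have h3 : Module.rank K (Submodule.span K {P'.mkQ c}) ≤ 1 := by
    simpa using rank_span_le (R := K) {P'.mkQ c}
  rw [rank_quotient_comap_subtype, rank_quotient_comap_subtype]
  calc Module.rank K (P.map P'.mkQ)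
      ≤ Module.rank K ↥(N.map P'.mkQ ⊔ Submodule.span K {P'.mkQ c}) := Submodule.rank_mono h1
    _ ≤ Module.rank K (N.map P'.mkQ) + Module.rank K (Submodule.span K {P'.mkQ c}) :=
        Submodule.rank_add_le_rank_add_rank _ _
    _ ≤ Module.rank K (Q.map Q'.mkQ) + 1 :=
        add_le_add (h2.trans (Submodule.rank_mono (Submodule.map_mono hNQ))) h3

variable {F G F' G' : V →ₗ[K] W} {v : V →ₗ[K] K} {f g : W}

/-- Rank-one perturbations change the Weyr characteristic upwards by at most one. -/
lemma rank_chainSubspace_quotient_le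
    (hF : ∀ x, F' x = F x + v x • f) (hG : ∀ x, G' x = G x + v x • g)
    (hinj : ∀ k x, IsPairChain F G k x → F (x k) = 0 → x k = 0) (k : ℕ) :
    Module.rank K (↥(chainSubspace F' G' (k + 1)) ⧸
        (chainSubspace F' G' k).comap (chainSubspace F' G' (k + 1)).subtype) ≤
      Module.rank K (↥(chainSubspace F G (k + 1)) ⧸
        (chainSubspace F G k).comap (chainSubspace F G (k + 1)).subtype) + 1 := by
  obtain ⟨z, hz, hle⟩ := exists_chain_chainSubspace_le F' G' v (k + 1)
  rw [chainSubspace_prod_congr hF hG] at hle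
  refine rank_quotient_le_add_one (c := z (k + 1)) (chainSubspace_prod_le F G v (k + 1)) ?_
    (hle.trans ?_)
  · refine (chainSubspace_prod_inf_le v hinj k).trans ?_
    rw [← chainSubspace_prod_congr hF hG]
    exact chainSubspace_prod_le F' G' v k
  · rw [sup_assoc]
    refine sup_le_sup_left (Submodule.span_le.2 ?_) _
    rintro _ ⟨⟨i, hi⟩, rfl⟩
    obtain h | rfl : i < k ∨ i = k := by omega
    · refine Submodule.mem_sup_left ⟨_, hz.delay (n := k) (k - (i + 1)) (by omega), ?_⟩
      change z (k - (k - (i + 1))) = z (i + 1)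
      congr 1
      omega
    · exact Submodule.mem_sup_right (Submodule.mem_span_singleton_self _)

/-- Rank-one perturbations increase the dimension of the `k`-th chain subspace by at most `k`. -/
lemma rank_chainSubspace_le
    (hF : ∀ x, F' x = F x + v x • f) (hG : ∀ x, G' x = G x + v x • g) (k : ℕ) :
    Module.rank K (chainSubspace F' G' k) ≤ Module.rank K (chainSubspace F G k) + k := by
  obtain ⟨z, -, hle⟩ := exists_chain_chainSubspace_le F' G' v k
  rw [chainSubspace_prod_congr hF hG] at hle
  have hspan : Module.rank K (Submodule.span K (Set.range fun i : Fin k => z (i + 1))) ≤ k := by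
    refine (rank_span_le _).trans ?_
    simpa using Cardinal.mk_range_le_lift (f := fun i : Fin k => z (i + 1))
  exact (Submodule.rank_mono hle).trans <| (Submodule.rank_add_le_rank_add_rank _ _).trans <|
    add_le_add (Submodule.rank_mono (chainSubspace_prod_le F G v k)) hspan

end RankBounds

section Pencil

variable {X : Type*} {Y : Type*} [NormedAddCommGroup X] [NormedSpace ℂ X]
  [NormedAddCommGroup Y] [NormedSpace ℂ Y]

/-- The restriction to `dom` of a bounded operator. -/
def restrictDom (E : X →L[ℂ] Y) (dom : Submodule ℂ X) : ↥dom →ₗ[ℂ] Y :=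
  (E : X →ₗ[ℂ] Y) ∘ₗ dom.subtype

lemma pencilRoot_eq (E : X →L[ℂ] Y) (dom : Submodule ℂ X) (A : ↥dom →ₗ[ℂ] Y) (l : ℂ) (k : ℕ) :
    pencilRoot E dom A l k =
      chainSubspace (restrictDom E dom) (A - l • restrictDom E dom) k := by
  ext x
  exact (mem_chainSubspace_iff_fin (F := restrictDom E dom)
    (G := A - l • restrictDom E dom)).symm

lemma pencilRootInf_eq (E : X →L[ℂ] Y) (dom : Submodule ℂ X) (A : ↥dom →ₗ[ℂ] Y) (k : ℕ) :
    pencilRootInf E dom A k = chainSubspace A (restrictDom E dom) k := by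
  ext x
  exact (mem_chainSubspace_iff_fin (F := A) (G := restrictDom E dom)).symm

variable {E : X →L[ℂ] Y} {dom : Submodule ℂ X} {A : ↥dom →ₗ[ℂ] Y}
  {Ehat : X →L[ℂ] Y} {Ahat : ↥dom →ₗ[ℂ] Y} {v' : X →L[ℂ] ℂ} {u w : Y}

/-- The Weyr characteristic grows by at most one under rank-one perturbations, provided the
unperturbed pencil has a left inverse at some point. -/
lemma weyr_le_weyr_add_one (hEhat : ∀ x : X, Ehat x = E x + v' x • u)
    (hAhat : ∀ x : ↥dom, Ahat x = A x + v' (x : X) • w)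
    {μ : ℂ} {T : Y →L[ℂ] X} (hTdom : ∀ y : Y, T y ∈ dom)
    (hT : ∀ x : ↥dom, T (A x - μ • E (x : X)) = (x : X)) (lam : Option ℂ) {k : ℕ} (hk : 1 ≤ k) :
    weyr Ehat dom Ahat lam k ≤ weyr E dom A lam k + 1 := by
  obtain ⟨k, rfl⟩ := Nat.exists_eq_add_of_le' hk
  have hE' : ∀ x, restrictDom Ehat dom x =
      restrictDom E dom x + restrictDom v' dom x • u := fun x => hEhat x
  let L : Y →ₗ[ℂ] ↥dom := (T : Y →ₗ[ℂ] X).codRestrict dom hTdom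
  have hL : ∀ y x, y = A x - μ • E (x : X) → L y = x := by
    rintro _ x rfl
    exact Subtype.ext (hT x)
  cases lam with
  | none =>
    simp only [weyr]
    rw [Nat.add_sub_cancel, pencilRootInf_eq E dom A (k + 1), pencilRootInf_eq E dom A k,
      pencilRootInf_eq Ehat dom Ahat (k + 1), pencilRootInf_eq Ehat dom Ahat k]
    refine rank_chainSubspace_quotient_le (v := restrictDom v' dom) hAhat hE' ?_ k
    intro k x hx h0
    refine hx.eq_zero_of_left_inverse L 1 (-μ) (fun z => hL _ _ ?_) h0
    simp [restrictDom, sub_eq_add_neg]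
  | some l =>
    simp only [weyr]
    rw [Nat.add_sub_cancel, pencilRoot_eq E dom A l (k + 1), pencilRoot_eq E dom A l k,
      pencilRoot_eq Ehat dom Ahat l (k + 1), pencilRoot_eq Ehat dom Ahat l k]
    refine rank_chainSubspace_quotient_le (v := restrictDom v' dom) (g := w - l • u) hE' ?_ ?_ k
    · intro x
      simp only [LinearMap.sub_apply, LinearMap.smul_apply, hE']
      rw [hAhat]
      change A x + restrictDom v' dom x • w - _ = _
      module
    · intro k x hx h0
      refine hx.eq_zero_of_left_inverse L (l - μ) 1 (fun z => hL _ _ ?_) h0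
      simp only [restrictDom, LinearMap.sub_apply, LinearMap.smul_apply, LinearMap.comp_apply,
        Submodule.subtype_apply, ContinuousLinearMap.coe_coe]
      module

/-- The dimension of `R_λ^k` grows by at most `k` under rank-one perturbations. -/
lemma rootDim_le_rootDim_add (hEhat : ∀ x : X, Ehat x = E x + v' x • u)
    (hAhat : ∀ x : ↥dom, Ahat x = A x + v' (x : X) • w) (lam : Option ℂ) (k : ℕ) :
    rootDim Ehat dom Ahat lam k ≤ rootDim E dom A lam k + k := by
  have hE' : ∀ x, restrictDom Ehat dom x =
      restrictDom E dom x + restrictDom v' dom x • u := fun x => hEhat x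
  cases lam with
  | none =>
    simp only [rootDim]
    rw [pencilRootInf_eq, pencilRootInf_eq]
    exact rank_chainSubspace_le (v := restrictDom v' dom) hAhat hE' k
  | some l =>
    simp only [rootDim]
    rw [pencilRoot_eq, pencilRoot_eq]
    refine rank_chainSubspace_le (v := restrictDom v' dom) (g := w - l • u) hE' ?_ k
    intro x
    simp only [LinearMap.sub_apply, LinearMap.smul_apply, hE']
    rw [hAhat]
    change A x + restrictDom v' dom x • w - _ = _
    module

end Pencil

/-- Under condition (torte), for the rank-one perturbation
`Ê = E + u v'`, `Â = A + w v'` (same functional `v'`), if the perturbed pencil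
`λ Ê - Â` also satisfies condition (torte), then for every `λ ∈ ℂ ∪ {∞}` and
`k ≥ 1` with `w_k(E,A;λ)` finite, `w_k(Ê,Â;λ)` is finite and
`|w_k(Ê,Â;λ) - w_k(E,A;λ)| ≤ 1`; moreover if `dim R_λ^k(E,A)` is finite then
`|dim R_λ^k(Ê,Â) - dim R_λ^k(E,A)| ≤ k`. -/
theorem stmt18 {X Y : Type*}
    [NormedAddCommGroup X] [NormedSpace ℂ X] [CompleteSpace X]
    [NormedAddCommGroup Y] [NormedSpace ℂ Y] [CompleteSpace Y]
    (E : X →L[ℂ] Y) (dom : Submodule ℂ X) (A : ↥dom →ₗ[ℂ] Y)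
    (hdense : Dense (dom : Set X))
    (hgraph : IsClosed {p : X × Y | ∃ x : ↥dom, p = ((x : X), A x)})
    (μ : ℂ) (T : Y →L[ℂ] X)
    (hTdom : ∀ y : Y, T y ∈ dom)
    (hT1 : ∀ y : Y, A ⟨T y, hTdom y⟩ - μ • E (T y) = y)
    (hT2 : ∀ x : ↥dom, T (A x - μ • E (x : X)) = (x : X))
    (u w : Y) (v' : X →L[ℂ] ℂ)
    (Ehat : X →L[ℂ] Y) (hEhat : ∀ x : X, Ehat x = E x + v' x • u)
    (Ahat : ↥dom →ₗ[ℂ] Y) (hAhat : ∀ x : ↥dom, Ahat x = A x + v' (x : X) • w)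
    (hgraphHat : IsClosed {p : X × Y | ∃ x : ↥dom, p = ((x : X), Ahat x)})
    (μhat : ℂ) (That : Y →L[ℂ] X)
    (hThatdom : ∀ y : Y, That y ∈ dom)
    (hThat1 : ∀ y : Y, Ahat ⟨That y, hThatdom y⟩ - μhat • Ehat (That y) = y)
    (hThat2 : ∀ x : ↥dom, That (Ahat x - μhat • Ehat (x : X)) = (x : X)) :
    ∀ (lam : Option ℂ) (k : ℕ), 1 ≤ k →
      weyr E dom A lam k < Cardinal.aleph0 →
      (weyr Ehat dom Ahat lam k < Cardinal.aleph0 ∧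
        weyr Ehat dom Ahat lam k ≤ weyr E dom A lam k + 1 ∧
        weyr E dom A lam k ≤ weyr Ehat dom Ahat lam k + 1) ∧
      (rootDim E dom A lam k < Cardinal.aleph0 →
        rootDim Ehat dom Ahat lam k ≤ rootDim E dom A lam k + (k : Cardinal) ∧
        rootDim E dom A lam k ≤ rootDim Ehat dom Ahat lam k + (k : Cardinal)) := by
  intro lam k hk hfin
  have hE : ∀ x : X, E x = Ehat x + v' x • -u := fun x => by rw [hEhat]; simp
  have hA : ∀ x : ↥dom, A x = Ahat x + v' (x : X) • -w := fun x => by rw [hAhat]; simp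
  have hle := weyr_le_weyr_add_one hEhat hAhat hTdom hT2 lam hk
  exact ⟨⟨hle.trans_lt (Cardinal.add_lt_aleph0 hfin Cardinal.one_lt_aleph0), hle,
      weyr_le_weyr_add_one hE hA hThatdom hThat2 lam hk⟩,
    fun _ => ⟨rootDim_le_rootDim_add hEhat hAhat lam k, rootDim_le_rootDim_add hE hA lam k⟩⟩
end

section
/- Let the pencil λE − A satisfy condition (torte). Let u ∈ Y, let v', w' : X → ℂ be continuous linear functionals, and define Ê x := E x + v'(x) u for x ∈ X and Â x := A x + w'(x) u for x ∈ dom Â := dom A. Assume that the perturbed pencil λÊ − Â also satisfies condition (torte) (i.e., there exist μ̂ ∈ ℂ and a bounded operator T̂ : Y → X with T̂ y ∈ dom A, (Â − μ̂ Ê)(T̂ y) = y for all y ∈ Y, and T̂((Â − μ̂ Ê) x) = x for all x ∈ dom A). Let λ ∈ ℂ or λ = ∞ and let k ≥ 1 be an integer such that w_k(E,A;λ) is finite. Then w_k(Ê,Â;λ) is finite and |w_k(Ê,Â;λ) − w_k(E,A;λ)| ≤ 1, i.e., w_k(Ê,Â;λ) ≤ w_k(E,A;λ) + 1 and w_k(E,A;λ)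 ≤ w_k(Ê,Â;λ) + 1. Moreover, if dim R_λ^k(E,A) is finite, then |dim R_λ^k(Ê,Â) − dim R_λ^k(E,A)| ≤ k. -/
variable {X Y : Type*} [NormedAddCommGroup X] [NormedSpace ℂ X]
  [NormedAddCommGroup Y] [NormedSpace ℂ Y]
  (E : X →L[ℂ] Y) (dom : Submodule ℂ X) (A : ↥dom →ₗ[ℂ] Y)

section Chains

variable {V W : Type*} [AddCommGroup V] [Module ℂ V] [AddCommGroup W] [Module ℂ W]

/-- Sequences with `z 0 = 0` that satisfy `F (z (j + 1)) = G (z j)` for `j < k`. -/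
def chainSpace (F G : V →ₗ[ℂ] W) (k : ℕ) : Submodule ℂ (ℕ → V) where
  carrier := {z | z 0 = 0 ∧ ∀ j < k, F (z (j + 1)) = G (z j)}
  zero_mem' := by simp
  add_mem' := by
    rintro a b ⟨ha0, ha⟩ ⟨hb0, hb⟩
    exact ⟨by simp [ha0, hb0], fun j hj => by simp [ha j hj, hb j hj]⟩
  smul_mem' := by
    rintro c a ⟨ha0, ha⟩
    exact ⟨by simp [ha0], fun j hj => by simp [ha j hj]⟩

/-- The `k`-th entries of chains of length `k`. -/
def chainEnds (F G : V →ₗ[ℂ] W) (k : ℕ) : Submodule ℂ V :=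
  (chainSpace F G k).map (LinearMap.proj k)

/-- The first entries of chains of length `k`. -/
def chainStarts (F G : V →ₗ[ℂ] W) (k : ℕ) : Submodule ℂ V :=
  (chainSpace F G k).map (LinearMap.proj 1)

/-- Shift a sequence `s` places to the right, filling with zeros. -/
def shiftSeq (s : ℕ) (z : ℕ → V) : ℕ → V := fun n => if n < s then 0 else z (n - s)

theorem shiftSeq_mem {F G : V →ₗ[ℂ] W} {k s : ℕ} {z : ℕ → V} (hz : z ∈ chainSpace F G k) :
    shiftSeq s z ∈ chainSpace F G (k + s) := by
  obtain ⟨h0, h⟩ := hz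
  refine ⟨?_, fun j hj => ?_⟩
  · rcases Nat.eq_zero_or_pos s with rfl | hs
    · simp [shiftSeq, h0]
    · simp [shiftSeq, hs]
  · rcases lt_trichotomy (j + 1) s with h1 | h1 | h1
    · simp [shiftSeq, h1, show j < s by omega]
    · simp [shiftSeq, ← h1, h0]
    · have := h (j - s) (by omega)
      simpa [shiftSeq, show ¬ (j + 1 < s) by omega, show ¬ (j < s) by omega,
        show j + 1 - s = j - s + 1 by omega] using this

theorem chainSpace_anti (F G : V →ₗ[ℂ] W) : Antitone (chainSpace F G) :=
  fun _ _ h _ hz => ⟨hz.1, fun j hj => hz.2 j (hj.trans_le h)⟩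

theorem chainEnds_mono (F G : V →ₗ[ℂ] W) (k : ℕ) :
    chainEnds F G k ≤ chainEnds F G (k + 1) := by
  rintro _ ⟨z, hz, rfl⟩
  exact ⟨shiftSeq 1 z, shiftSeq_mem hz, by simp [shiftSeq]⟩

/-- A chain of a regular pencil that ends in zero starts with zero. -/
theorem chain_start_eq_zero {F G : V →ₗ[ℂ] W} {α β : ℂ} {L : W →ₗ[ℂ] V}
    (hL : ∀ x, L (α • F x + β • G x) = x) {k : ℕ} {z : ℕ → V}
    (hz : z ∈ chainSpace F G (k + 1)) (hk : z (k + 1) = 0) : z 1 = 0 := by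
  obtain ⟨h0, h⟩ := hz
  have hF1 : F (z 1) = 0 := by simpa [h0] using h 0 (by omega)
  have hfix : β • L (G (z 1)) = z 1 := by simpa [hF1] using hL (z 1)
  by_cases hβ : β = 0
  · simpa [hβ] using hfix.symm
  have hN : ∀ x, L (G x) = β⁻¹ • (x - α • L (F x)) := fun x => by
    have := hL x
    rw [map_add, map_smul, map_smul] at this
    rw [eq_inv_smul_iff₀ hβ, eq_sub_iff_add_eq']
    exact this
  set N : Module.End ℂ V := L ∘ₗ G with hNdef
  set S : Module.End ℂ V := L ∘ₗ F with hSdef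
  have hcomm : Commute N S := by
    ext x
    have h1 := hN (L (F x))
    have h2 := congrArg (fun y => L (F y)) (hN x)
    simp only [map_smul, map_sub] at h2
    exact h1.trans h2.symm
  have hstep : ∀ j ≤ k, (N ^ j) (z (k + 1 - j)) = 0 := by
    intro j
    induction j with
    | zero => simp [hk]
    | succ j ih =>
      intro hj
      have hz' : N (z (k + 1 - (j + 1))) = S (z (k + 1 - j)) := by
        have := h (k - j) (by omega)
        rw [show k + 1 - (j + 1) = k - j by omega, show k + 1 - j = k - j + 1 by omega]
        exact (congrArg L this).symm
      rw [pow_succ, Module.End.mul_apply, hz', ← Module.End.mul_apply,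
        (hcomm.pow_left j).eq, Module.End.mul_apply, ih (by omega), map_zero]
  have hpow : ∀ j : ℕ, β ^ j • (N ^ j) (z 1) = z 1 := by
    intro j
    induction j with
    | zero => simp
    | succ j ih =>
      rw [pow_succ, pow_succ, Module.End.mul_apply, mul_smul, ← map_smul]
      exact (congrArg (fun y => β ^ j • (N ^ j) y) hfix).trans ih
  have := hstep k le_rfl
  rw [show k + 1 - k = 1 by omega] at this
  rw [← hpow k, this, smul_zero]

theorem rank_chainEnds_quotient {F G : V →ₗ[ℂ] W} {α β : ℂ} {L : W →ₗ[ℂ] V}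
    (hL : ∀ x, L (α • F x + β • G x) = x) (k : ℕ) :
    Module.rank ℂ (↥(chainEnds F G (k + 1)) ⧸
      (chainEnds F G k).comap (chainEnds F G (k + 1)).subtype) =
      Module.rank ℂ (chainStarts F G (k + 1)) := by
  set C := chainSpace F G (k + 1)
  let e : C →ₗ[ℂ] chainEnds F G (k + 1) := (LinearMap.proj (k + 1)).submoduleMap C
  let s : C →ₗ[ℂ] chainStarts F G (k + 1) := (LinearMap.proj 1).submoduleMap C
  let q := ((chainEnds F G k).comap (chainEnds F G (k + 1)).subtype).mkQ ∘ₗ e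
  have he : Function.Surjective q :=
    (Submodule.mkQ_surjective _).comp (LinearMap.submoduleMap_surjective _ _)
  have hs : Function.Surjective s := LinearMap.submoduleMap_surjective _ _
  have hker : LinearMap.ker q = LinearMap.ker s := by
    ext ⟨z, hz⟩
    have h1 : (⟨z, hz⟩ : C) ∈ LinearMap.ker q ↔ z (k + 1) ∈ chainEnds F G k := by
      simp only [q, LinearMap.mem_ker, LinearMap.comp_apply, Submodule.mkQ_apply,
        Submodule.Quotient.mk_eq_zero, Submodule.mem_comap]
      rfl
    have h2 : (⟨z, hz⟩ : C) ∈ LinearMap.ker s ↔ z 1 = 0 := by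
      rw [LinearMap.mem_ker, Subtype.ext_iff]
      rfl
    rw [h1, h2]
    constructor
    · rintro ⟨y, hy, hyz⟩
      have hmem := sub_mem hz (shiftSeq_mem (s := 1) hy)
      have hy0 : y 0 = 0 := hy.1
      simpa [shiftSeq, hy0] using chain_start_eq_zero hL hmem
        (by simpa [shiftSeq, sub_eq_zero] using hyz.symm)
    · intro h
      refine ⟨fun n => z (n + 1), ⟨h, fun j hj => hz.2 (j + 1) (by omega)⟩, rfl⟩
  exact ((q.quotKerEquivOfSurjective he).symm.trans
    ((Submodule.quotEquivOfEq _ _ hker).trans (s.quotKerEquivOfSurjective hs))).rank_eq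

theorem rank_chainEnds_succ {F G : V →ₗ[ℂ] W} {α β : ℂ} {L : W →ₗ[ℂ] V}
    (hL : ∀ x, L (α • F x + β • G x) = x) (k : ℕ) :
    Module.rank ℂ (chainEnds F G (k + 1)) =
      Module.rank ℂ (chainStarts F G (k + 1)) + Module.rank ℂ (chainEnds F G k) := by
  rw [← rank_chainEnds_quotient hL k,
    ← (Submodule.comapSubtypeEquivOfLe (chainEnds_mono F G k)).rank_eq]
  exact (Submodule.rank_quotient_add_rank _).symm

/-- Starting vectors change by at most one dimension under a rank-one perturbation. -/
theorem exists_chainStarts_le {F G F' G' : V →ₗ[ℂ] W} {f g : V →ₗ[ℂ] ℂ} {u : W}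
    (hF : ∀ x, F' x = F x + f x • u) (hG : ∀ x, G' x = G x + g x • u) (k : ℕ) :
    ∃ v : V, chainStarts F' G' k ≤ chainStarts F G k ⊔ ℂ ∙ v := by
  classical
  let c : ℕ → (ℕ → V) → ℂ := fun j z => g (z j) - f (z (j + 1))
  have hc : ∀ z ∈ chainSpace F' G' k, (∀ j < k, c j z = 0) → z ∈ chainSpace F G k := by
    refine fun z hz hcz => ⟨hz.1, fun j hj => ?_⟩
    have h1 := hz.2 j hj
    rw [hF, hG, ← sub_eq_zero.1 (hcz j hj)] at h1
    exact add_right_cancel h1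
  by_cases hex : ∃ m, m < k ∧ ∃ z ∈ chainSpace F' G' k, c m z ≠ 0
  swap
  · refine ⟨0, ?_⟩
    rintro _ ⟨z, hz, rfl⟩
    refine Submodule.mem_sup_left ⟨z, hc z hz fun j hj => ?_, rfl⟩
    by_contra h
    exact hex ⟨j, hj, z, hz, h⟩
  obtain ⟨m, hmk, y, hy, hcy, hmin⟩ : ∃ m, m < k ∧ ∃ y ∈ chainSpace F' G' k, c m y ≠ 0 ∧
      ∀ i < m, ∀ z ∈ chainSpace F' G' k, c i z = 0 := by
    obtain ⟨hmk, y, hy, hcy⟩ := Nat.find_spec hex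
    refine ⟨Nat.find hex, hmk, y, hy, hcy, fun i hi z hz => ?_⟩
    by_contra h
    exact Nat.find_min hex hi ⟨hi.trans hmk, z, hz, h⟩
  have hy0 : y 0 = 0 := hy.1
  have hshift : ∀ s i, c i (shiftSeq s y) = if i < s then 0 else c (i - s) y := by
    intro s i
    rcases lt_trichotomy (i + 1) s with h1 | h1 | h1
    · simp [c, shiftSeq, h1, show i < s by omega]
    · simp [c, shiftSeq, ← h1, hy0]
    · simp [c, shiftSeq, show ¬ (i + 1 < s) by omega, show ¬ (i < s) by omega,
        show i + 1 - s = i - s + 1 by omega]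
  refine ⟨y 1, ?_⟩
  rintro _ ⟨z, hz, rfl⟩
  have key : ∀ n ≤ k, ∃ x ∈ chainSpace F' G' k, (∀ i < n, c i x = 0) ∧
      z 1 - x 1 ∈ ℂ ∙ y 1 := by
    intro n
    induction n with
    | zero => exact fun _ => ⟨z, hz, by simp, by simp⟩
    | succ n ih =>
      intro hn
      obtain ⟨x, hx, hcx, hzx⟩ := ih (by omega)
      rcases lt_or_ge n m with hnm | hnm
      · exact ⟨x, hx, fun i hi => hmin i (by omega) x hx, hzx⟩
      have hsy : shiftSeq (n - m) y ∈ chainSpace F' G' k :=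
        chainSpace_anti F' G' (by omega) (shiftSeq_mem hy)
      have hsub : ∀ i (a : ℂ), c i (x - a • shiftSeq (n - m) y) =
          c i x - a * c i (shiftSeq (n - m) y) := by
        intro i a
        simp only [c, Pi.sub_apply, Pi.smul_apply, map_sub, map_smul, smul_eq_mul]
        ring
      refine ⟨x - (c n x / c m y) • shiftSeq (n - m) y,
        sub_mem hx (Submodule.smul_mem _ _ hsy), fun i hi => ?_, ?_⟩
      · rw [hsub, hshift]
        rcases Nat.lt_succ_iff_lt_or_eq.1 hi with hi' | rfl
        · rw [hcx i hi']
          split_ifs with h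
          · simp
          · rw [hmin (i - (n - m)) (by omega) y hy]
            simp
        · rw [if_neg (by omega), show i - (i - m) = m by omega, div_mul_cancel₀ _ hcy, sub_self]
      · have h1 : shiftSeq (n - m) y 1 ∈ ℂ ∙ y 1 := by
          unfold shiftSeq
          split_ifs with h
          · exact zero_mem _
          · rcases (show n - m = 0 ∨ n - m = 1 by omega) with h | h <;>
              simp [h, hy0, Submodule.mem_span_singleton_self]
        have := add_mem hzx (Submodule.smul_mem _ (c n x / c m y) h1)
        convert this using 1
        simp only [Pi.sub_apply, Pi.smul_apply]
        abel
  obtain ⟨x, hx, hcx, hzx⟩ := key k le_rfl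
  have : z 1 = x 1 + (z 1 - x 1) := by abel
  change z 1 ∈ _
  rw [this]
  exact Submodule.add_mem_sup ⟨x, hc x hx hcx, rfl⟩ hzx

theorem rank_chainStarts_le {F G F' G' : V →ₗ[ℂ] W} {f g : V →ₗ[ℂ] ℂ} {u : W}
    (hF : ∀ x, F' x = F x + f x • u) (hG : ∀ x, G' x = G x + g x • u) (k : ℕ) :
    Module.rank ℂ (chainStarts F' G' k) ≤ Module.rank ℂ (chainStarts F G k) + 1 := by
  obtain ⟨v, hv⟩ := exists_chainStarts_le hF hG k
  refine (Submodule.rank_mono hv).trans ((Submodule.rank_add_le_rank_add_rank _ _).trans ?_)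
  gcongr
  exact (rank_span_le _).trans (by simp)

theorem rank_chainEnds_le {F G F' G' : V →ₗ[ℂ] W} {f g : V →ₗ[ℂ] ℂ} {u : W}
    (hF : ∀ x, F' x = F x + f x • u) (hG : ∀ x, G' x = G x + g x • u)
    {α β α' β' : ℂ} {L L' : W →ₗ[ℂ] V} (hL : ∀ x, L (α • F x + β • G x) = x)
    (hL' : ∀ x, L' (α' • F' x + β' • G' x) = x) (k : ℕ) :
    Module.rank ℂ (chainEnds F' G' k) ≤ Module.rank ℂ (chainEnds F G k) + (k : Cardinal) := by
  induction k with
  | zero =>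
    have : chainEnds F' G' 0 = ⊥ := by
      rw [eq_bot_iff]
      rintro _ ⟨z, hz, rfl⟩
      exact hz.1
    rw [this, rank_bot]
    exact zero_le
  | succ k ih =>
    rw [rank_chainEnds_succ hL, rank_chainEnds_succ hL']
    refine (add_le_add (rank_chainStarts_le hF hG (k + 1)) ih).trans (le_of_eq ?_)
    push_cast
    ring

/-- The comparison of two regular pencils that differ by a rank-one perturbation. -/
theorem chain_rank_comparison {F G F' G' : V →ₗ[ℂ] W} {f g : V →ₗ[ℂ] ℂ} {u : W}
    (hF : ∀ x, F' x = F x + f x • u) (hG : ∀ x, G' x = G x + g x • u)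
    {α β α' β' : ℂ} {L L' : W →ₗ[ℂ] V} (hL : ∀ x, L (α • F x + β • G x) = x)
    (hL' : ∀ x, L' (α' • F' x + β' • G' x) = x) {k : ℕ} (hk : 1 ≤ k) :
    (Module.rank ℂ (↥(chainEnds F' G' k) ⧸
        (chainEnds F' G' (k - 1)).comap (chainEnds F' G' k).subtype) ≤
      Module.rank ℂ (↥(chainEnds F G k) ⧸
        (chainEnds F G (k - 1)).comap (chainEnds F G k).subtype) + 1) ∧
    (Module.rank ℂ (↥(chainEnds F G k) ⧸
        (chainEnds F G (k - 1)).comap (chainEnds F G k).subtype) ≤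
      Module.rank ℂ (↥(chainEnds F' G' k) ⧸
        (chainEnds F' G' (k - 1)).comap (chainEnds F' G' k).subtype) + 1) ∧
    Module.rank ℂ (chainEnds F' G' k) ≤ Module.rank ℂ (chainEnds F G k) + (k : Cardinal) ∧
    Module.rank ℂ (chainEnds F G k) ≤ Module.rank ℂ (chainEnds F' G' k) + (k : Cardinal) := by
  obtain ⟨k, rfl⟩ := Nat.exists_eq_add_of_le' hk
  have hF' : ∀ x, F x = F' x + (-f) x • u := fun x => by simp [hF]
  have hG' : ∀ x, G x = G' x + (-g) x • u := fun x => by simp [hG]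
  rw [Nat.add_sub_cancel, rank_chainEnds_quotient hL, rank_chainEnds_quotient hL']
  exact ⟨rank_chainStarts_le hF hG _, rank_chainStarts_le hF' hG' _,
    rank_chainEnds_le hF hG hL hL' _, rank_chainEnds_le hF' hG' hL' hL _⟩

theorem mem_chainEnds_iff_fin {F G : V →ₗ[ℂ] W} {k : ℕ} {x : V} :
    x ∈ chainEnds F G k ↔ ∃ z : Fin (k + 1) → V, z 0 = 0 ∧ z (Fin.last k) = x ∧
      ∀ j : Fin k, F (z j.succ) = G (z j.castSucc) := by
  constructor
  · rintro ⟨z, hz, rfl⟩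
    exact ⟨fun i => z i, hz.1, rfl, fun j => hz.2 j j.2⟩
  · rintro ⟨z, h0, rfl, h⟩
    refine ⟨fun n => if hn : n < k + 1 then z ⟨n, hn⟩ else 0, ⟨?_, fun j hj => ?_⟩, ?_⟩
    · simpa using h0
    · simpa [hj, show j < k + 1 by omega] using h ⟨j, hj⟩
    · simp [Fin.last]

end Chains

theorem pencilRoot_eq_chainEnds {X Y : Type*} [NormedAddCommGroup X] [NormedSpace ℂ X]
    [NormedAddCommGroup Y] [NormedSpace ℂ Y]
    (E : X →L[ℂ] Y) (dom : Submodule ℂ X) (A : ↥dom →ₗ[ℂ] Y)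
    (l : ℂ) (k : ℕ) :
    pencilRoot E dom A l k =
      chainEnds (A - l • (E.toLinearMap ∘ₗ dom.subtype)) (E.toLinearMap ∘ₗ dom.subtype) k := by
  ext x
  exact (mem_chainEnds_iff_fin (F := (A - l • (E.toLinearMap ∘ₗ dom.subtype)))
    (G := (E.toLinearMap ∘ₗ dom.subtype))).symm

theorem weyr_some_eq {X Y : Type*} [NormedAddCommGroup X] [NormedSpace ℂ X]
    [NormedAddCommGroup Y] [NormedSpace ℂ Y]
    (E : X →L[ℂ] Y) (dom : Submodule ℂ X) (A : ↥dom →ₗ[ℂ] Y)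
    (l : ℂ) (k : ℕ) :
    weyr E dom A (some l) k = Module.rank ℂ
      (↥(chainEnds (A - l • (E.toLinearMap ∘ₗ dom.subtype)) (E.toLinearMap ∘ₗ dom.subtype) k) ⧸
        (chainEnds (A - l • (E.toLinearMap ∘ₗ dom.subtype)) (E.toLinearMap ∘ₗ dom.subtype) (k - 1)).comap
          (chainEnds (A - l • (E.toLinearMap ∘ₗ dom.subtype)) (E.toLinearMap ∘ₗ dom.subtype) k).subtype) := by
  rw [← pencilRoot_eq_chainEnds, ← pencilRoot_eq_chainEnds]
  rfl

theorem rootDim_some_eq {X Y : Type*} [NormedAddCommGroup X] [NormedSpace ℂ X]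
    [NormedAddCommGroup Y] [NormedSpace ℂ Y]
    (E : X →L[ℂ] Y) (dom : Submodule ℂ X) (A : ↥dom →ₗ[ℂ] Y)
    (l : ℂ) (k : ℕ) :
    rootDim E dom A (some l) k = Module.rank ℂ
      (chainEnds (A - l • (E.toLinearMap ∘ₗ dom.subtype)) (E.toLinearMap ∘ₗ dom.subtype) k) := by
  rw [← pencilRoot_eq_chainEnds]
  rfl

theorem pencilRootInf_eq_chainEnds {X Y : Type*} [NormedAddCommGroup X] [NormedSpace ℂ X]
    [NormedAddCommGroup Y] [NormedSpace ℂ Y]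
    (E : X →L[ℂ] Y) (dom : Submodule ℂ X) (A : ↥dom →ₗ[ℂ] Y)
    (k : ℕ) :
    pencilRootInf E dom A k =
      chainEnds (E.toLinearMap ∘ₗ dom.subtype) A k := by
  ext x
  exact (mem_chainEnds_iff_fin (F := (E.toLinearMap ∘ₗ dom.subtype))
    (G := A)).symm

theorem weyr_none_eq {X Y : Type*} [NormedAddCommGroup X] [NormedSpace ℂ X]
    [NormedAddCommGroup Y] [NormedSpace ℂ Y]
    (E : X →L[ℂ] Y) (dom : Submodule ℂ X) (A : ↥dom →ₗ[ℂ] Y)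
    (k : ℕ) :
    weyr E dom A none k = Module.rank ℂ
      (↥(chainEnds (E.toLinearMap ∘ₗ dom.subtype) A k) ⧸
        (chainEnds (E.toLinearMap ∘ₗ dom.subtype) A (k - 1)).comap
          (chainEnds (E.toLinearMap ∘ₗ dom.subtype) A k).subtype) := by
  rw [← pencilRootInf_eq_chainEnds, ← pencilRootInf_eq_chainEnds]
  rfl

theorem rootDim_none_eq {X Y : Type*} [NormedAddCommGroup X] [NormedSpace ℂ X]
    [NormedAddCommGroup Y] [NormedSpace ℂ Y]
    (E : X →L[ℂ] Y) (dom : Submodule ℂ X) (A : ↥dom →ₗ[ℂ] Y)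
    (k : ℕ) :
    rootDim E dom A none k = Module.rank ℂ
      (chainEnds (E.toLinearMap ∘ₗ dom.subtype) A k) := by
  rw [← pencilRootInf_eq_chainEnds]
  rfl

/-- Under condition (torte), for the rank-one perturbation
`Ê = E + u v'`, `Â = A + u w'` (same vector `u`), if the perturbed pencil
`λ Ê - Â` also satisfies condition (torte), then for every `λ ∈ ℂ ∪ {∞}` and
`k ≥ 1` with `w_k(E,A;λ)` finite, `w_k(Ê,Â;λ)` is finite and
`|w_k(Ê,Â;λ) - w_k(E,A;λ)| ≤ 1`; moreover if `dim R_λ^k(E,A)` is finite then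
`|dim R_λ^k(Ê,Â) - dim R_λ^k(E,A)| ≤ k`. -/
theorem stmt19 {X Y : Type*}
    [NormedAddCommGroup X] [NormedSpace ℂ X] [CompleteSpace X]
    [NormedAddCommGroup Y] [NormedSpace ℂ Y] [CompleteSpace Y]
    (E : X →L[ℂ] Y) (dom : Submodule ℂ X) (A : ↥dom →ₗ[ℂ] Y)
    (hdense : Dense (dom : Set X))
    (hgraph : IsClosed {p : X × Y | ∃ x : ↥dom, p = ((x : X), A x)})
    (μ : ℂ) (T : Y →L[ℂ] X)
    (hTdom : ∀ y : Y, T y ∈ dom)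
    (hT1 : ∀ y : Y, A ⟨T y, hTdom y⟩ - μ • E (T y) = y)
    (hT2 : ∀ x : ↥dom, T (A x - μ • E (x : X)) = (x : X))
    (u : Y) (v' w' : X →L[ℂ] ℂ)
    (Ehat : X →L[ℂ] Y) (hEhat : ∀ x : X, Ehat x = E x + v' x • u)
    (Ahat : ↥dom →ₗ[ℂ] Y) (hAhat : ∀ x : ↥dom, Ahat x = A x + w' (x : X) • u)
    (hgraphHat : IsClosed {p : X × Y | ∃ x : ↥dom, p = ((x : X), Ahat x)})
    (μhat : ℂ) (That : Y →L[ℂ] X)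
    (hThatdom : ∀ y : Y, That y ∈ dom)
    (hThat1 : ∀ y : Y, Ahat ⟨That y, hThatdom y⟩ - μhat • Ehat (That y) = y)
    (hThat2 : ∀ x : ↥dom, That (Ahat x - μhat • Ehat (x : X)) = (x : X)) :
    ∀ (lam : Option ℂ) (k : ℕ), 1 ≤ k →
      weyr E dom A lam k < Cardinal.aleph0 →
      (weyr Ehat dom Ahat lam k < Cardinal.aleph0 ∧
        weyr Ehat dom Ahat lam k ≤ weyr E dom A lam k + 1 ∧
        weyr E dom A lam k ≤ weyr Ehat dom Ahat lam k + 1) ∧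
      (rootDim E dom A lam k < Cardinal.aleph0 →
        rootDim Ehat dom Ahat lam k ≤ rootDim E dom A lam k + (k : Cardinal) ∧
        rootDim E dom A lam k ≤ rootDim Ehat dom Ahat lam k + (k : Cardinal)) := by
  intro lam k hk hfin
  let S : Y →ₗ[ℂ] ↥dom := T.toLinearMap.codRestrict dom hTdom
  let S' : Y →ₗ[ℂ] ↥dom := That.toLinearMap.codRestrict dom hThatdom
  have hS : ∀ x : ↥dom, S (A x - μ • E (x : X)) = x := fun x => Subtype.ext (hT2 x)
  have hS' : ∀ x : ↥dom, S' (Ahat x - μhat • Ehat (x : X)) = x :=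
    fun x => Subtype.ext (hThat2 x)
  have main : (weyr Ehat dom Ahat lam k ≤ weyr E dom A lam k + 1 ∧
      weyr E dom A lam k ≤ weyr Ehat dom Ahat lam k + 1 ∧
      rootDim Ehat dom Ahat lam k ≤ rootDim E dom A lam k + (k : Cardinal) ∧
      rootDim E dom A lam k ≤ rootDim Ehat dom Ahat lam k + (k : Cardinal)) := by
    cases lam with
    | some l =>
      rw [weyr_some_eq, weyr_some_eq, rootDim_some_eq, rootDim_some_eq]
      refine chain_rank_comparison
        (f := (w' - l • v').toLinearMap ∘ₗ dom.subtype) (g := v'.toLinearMap ∘ₗ dom.subtype)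
        (u := u) (α := 1) (β := l - μ) (α' := 1) (β' := l - μhat) (L := S) (L' := S')
        (fun x => ?_) (fun x => hEhat x) (fun x => ?_) (fun x => ?_) hk
      · simp [hEhat, hAhat, sub_smul, mul_smul]
        abel
      · refine Eq.trans (congrArg S ?_) (hS x)
        simp [sub_smul]
      · refine Eq.trans (congrArg S' ?_) (hS' x)
        simp [sub_smul]
    | none =>
      rw [weyr_none_eq, weyr_none_eq, rootDim_none_eq, rootDim_none_eq]
      refine chain_rank_comparison
        (f := v'.toLinearMap ∘ₗ dom.subtype) (g := w'.toLinearMap ∘ₗ dom.subtype)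
        (u := u) (α := -μ) (β := 1) (α' := -μhat) (β' := 1) (L := S) (L' := S')
        (fun x => hEhat x) (fun x => hAhat x) (fun x => ?_) (fun x => ?_) hk
      · refine Eq.trans (congrArg S ?_) (hS x)
        simp [neg_add_eq_sub]
      · refine Eq.trans (congrArg S' ?_) (hS' x)
        simp [neg_add_eq_sub]
  exact ⟨⟨main.1.trans_lt (Cardinal.add_lt_aleph0 hfin Cardinal.one_lt_aleph0),
    main.1, main.2.1⟩, fun _ => main.2.2⟩
end
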